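/- arXiv:2010.07902 — 3 statements merged into one kernel-verified Lean document; each statement's English description precedes it below -/
import Mathlib

section
/- Catalytic quantum Singleton bound, case 2(d−1) < n. Let q ≥ 2, d ≥ 2, and 2(d−1) < n. Let ψ be a pure quantum state on A_f ⊗ F ⊗ X_1 ⊗ … ⊗ X_n ⊗ B_in, where each X_i has dimension q and A_f, F, B_in are arbitrary finite-dimensional systems. Suppose that for every partition {1,…,n} = I ∪ J with |I| = n−d+1 and |J| = d−1, the equality S(X_I B_in)_ψ = S(A_f)_ψ + S(F X_J)_ψ holds. Then S(A_f)_ψ − S(B_in)_ψ ≤ (n−2d+2)·σ̄ ≤ (n−2d+2)·log q, where σ̄ := (1/(d−1))·E_{|J|=d−1} S(X_J)_ψ. -/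
open scoped BigOperators ComplexOrder

/-- Von Neumann entropy of a matrix: `-∑ λ_j log λ_j` over the eigenvalues,
if the matrix is Hermitian (else junk value 0). Natural logarithm,
with the convention `0 * log 0 = 0` (automatic since `Real.log 0 = 0`). -/
noncomputable def vnEntropy {m : Type*} [Fintype m] [DecidableEq m]
    (ρ : Matrix m m ℂ) : ℝ :=
  if h : ρ.IsHermitian then
    -∑ j, h.eigenvalues j * Real.log (h.eigenvalues j)
  else 0

/-- Marginal (partial trace) of a state on the composite system
`⨂_{i : ι} X_i` (with `X_i = ℂ^{dim i}`), keeping the factors in `S`. -/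
noncomputable def marginal {ι : Type*} [Fintype ι] [DecidableEq ι]
    {dim : ι → ℕ}
    (ρ : Matrix ((i : ι) → Fin (dim i)) ((i : ι) → Fin (dim i)) ℂ)
    (S : Finset ι) :
    Matrix ((i : {j : ι // j ∈ S}) → Fin (dim i.1))
           ((i : {j : ι // j ∈ S}) → Fin (dim i.1)) ℂ :=
  fun x y =>
    ∑ z : (i : {j : ι // j ∉ S}) → Fin (dim i.1),
      ρ (fun i => if h : i ∈ S then x ⟨i, h⟩ else z ⟨i, h⟩)
        (fun i => if h : i ∈ S then y ⟨i, h⟩ else z ⟨i, h⟩)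

/-- Entropy of the marginal of `ρ` on the factors in `S`. -/
noncomputable def mEnt {ι : Type*} [Fintype ι] [DecidableEq ι]
    {dim : ι → ℕ}
    (ρ : Matrix ((i : ι) → Fin (dim i)) ((i : ι) → Fin (dim i)) ℂ)
    (S : Finset ι) : ℝ :=
  vnEntropy (marginal ρ S)

namespace CatalyticSingleton



open Matrix

lemma cs_spectral {m : Type*} [Fintype m] [DecidableEq m] {A : Matrix m m ℂ}
    (hA : A.IsHermitian) :
    ∃ U : Matrix m m ℂ, U * Uᴴ = 1 ∧ Uᴴ * U = 1 ∧
      A = U * diagonal (fun i => (hA.eigenvalues i : ℂ)) * Uᴴ := by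
  refine ⟨hA.eigenvectorUnitary, ?_, ?_, ?_⟩
  · exact (Unitary.mem_iff.mp hA.eigenvectorUnitary.2).2
  · exact (Unitary.mem_iff.mp hA.eigenvectorUnitary.2).1
  · conv_lhs => rw [hA.spectral_theorem, Unitary.conjStarAlgAut_apply]
    rfl

lemma cs_vnEntropy_eq {m : Type*} [Fintype m] [DecidableEq m] {A : Matrix m m ℂ}
    (hA : A.IsHermitian) :
    vnEntropy A = -∑ j, hA.eigenvalues j * Real.log (hA.eigenvalues j) := by
  unfold vnEntropy
  rw [dif_pos hA]

lemma cs_vnEntropy_roots {m : Type*} [Fintype m] [DecidableEq m] {A : Matrix m m ℂ}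
    (hA : A.IsHermitian) :
    vnEntropy A = (A.charpoly.roots.map (fun z => Real.negMulLog z.re)).sum := by
  rw [cs_vnEntropy_eq hA, hA.roots_charpoly_eq_eigenvalues, Multiset.map_map]
  rw [← Finset.sum_neg_distrib]
  rw [Finset.sum_eq_multiset_sum]
  congr 1
  refine Multiset.map_congr rfl fun j _ => ?_
  simp [Real.negMulLog]

lemma cs_vnEntropy_submatrix {m k : Type*} [Fintype m] [DecidableEq m] [Fintype k] [DecidableEq k]
    {A : Matrix m m ℂ} (hA : A.IsHermitian) (e : k ≃ m) :
    vnEntropy (A.submatrix e e) = vnEntropy A := by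
  rw [cs_vnEntropy_roots hA, cs_vnEntropy_roots (hA.submatrix e)]
  have := charpoly_reindex e.symm A
  simp only [reindex_apply, Equiv.symm_symm] at this
  rw [this]

lemma cs_roots_X_pow (k : ℕ) (P : Polynomial ℂ) (hP : P ≠ 0) :
    (((Polynomial.X ^ k * P).roots.map (fun z : ℂ => Real.negMulLog z.re)).sum)
      = (P.roots.map (fun z : ℂ => Real.negMulLog z.re)).sum := by
  rw [Polynomial.roots_mul (mul_ne_zero (pow_ne_zero _ Polynomial.X_ne_zero) hP)]
  simp [Multiset.map_nsmul, Multiset.sum_nsmul]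

lemma cs_vnEntropy_schmidt {m k : Type*} [Fintype m] [DecidableEq m] [Fintype k] [DecidableEq k]
    (M : Matrix m k ℂ) :
    vnEntropy (M * Mᴴ) = vnEntropy ((Mᴴ * M)ᵀ) := by
  have h1 : (M * Mᴴ).IsHermitian := isHermitian_mul_conjTranspose_self M
  have h2 : (Mᴴ * M).IsHermitian := isHermitian_conjTranspose_mul_self M
  rw [cs_vnEntropy_roots h1, cs_vnEntropy_roots h2.transpose, charpoly_transpose]
  rw [← cs_roots_X_pow (Fintype.card k) _ (charpoly_monic _).ne_zero,
    ← cs_roots_X_pow (Fintype.card m) _ (charpoly_monic (Mᴴ * M)).ne_zero, charpoly_mul_comm']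

lemma cs_sum_eigenvalues {m : Type*} [Fintype m] [DecidableEq m] {A : Matrix m m ℂ}
    (hA : A.IsHermitian) (htr : A.trace = 1) : ∑ i, hA.eigenvalues i = 1 := by
  have := hA.trace_eq_sum_eigenvalues
  rw [htr] at this
  have h2 := congrArg Complex.re this
  simpa using h2.symm

lemma cs_vnEntropy_le {m : Type*} [Fintype m] [DecidableEq m] {A : Matrix m m ℂ}
    (hA : A.PosSemidef) (htr : A.trace = 1) : vnEntropy A ≤ Real.log (Fintype.card m) := by
  have hs := cs_sum_eigenvalues hA.1 htr
  have hne : Nonempty m := by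
    by_contra h
    rw [not_nonempty_iff] at h
    simp at hs
  have hc : (0:ℝ) < Fintype.card m := by exact_mod_cast Fintype.card_pos
  rw [cs_vnEntropy_eq hA.1]
  have := Real.concaveOn_negMulLog.le_map_sum (t := Finset.univ)
    (w := fun _ : m => (1:ℝ) / Fintype.card m) (p := hA.1.eigenvalues)
    (fun i _ => by positivity) (by simp) (fun i _ => hA.eigenvalues_nonneg i)
  simp only [smul_eq_mul, ← Finset.mul_sum, hs, mul_one] at this
  have h3 : Real.negMulLog (1 / (Fintype.card m : ℝ)) =
      (1 / Fintype.card m) * Real.log (Fintype.card m) := by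
    simp [Real.negMulLog]
  rw [h3] at this
  have h4 := le_of_mul_le_mul_left this (by positivity)
  simpa [Real.negMulLog] using h4


lemma cs_scalar_le (p s : ℝ) (hs : 0 < s) (c y : ℂ) :
    2 * p * (c * y).re - s * Complex.normSq y ≤ Complex.normSq c * (p * (p / s)) := by
  have : Complex.normSq c * (p * (p / s)) = (Complex.normSq c * p ^ 2) / s := by ring
  rw [this, le_div_iff₀ hs]
  simp only [Complex.normSq_apply, Complex.mul_re]
  nlinarith [sq_nonneg (s * y.re - p * c.re), sq_nonneg (s * y.im + p * c.im)]

lemma cs_scalar_eq (p s : ℝ) (hs : 0 < s) (c : ℂ) :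
    2 * p * (c * (((p / s : ℝ) : ℂ) * star c)).re
      - s * Complex.normSq (((p / s : ℝ) : ℂ) * star c) = Complex.normSq c * (p * (p / s)) := by
  simp [Complex.normSq_apply]
  field_simp
  ring

/-- The quadratic functional whose supremum is the resolvent form. -/
noncomputable def csL {m : Type*} [Fintype m] (ρ σ : Matrix m m ℂ) (t : ℝ) (X : Matrix m m ℂ) : ℝ :=
  2 * (ρ * X).trace.re - (σ * (X * Xᴴ)).trace.re - t * (ρ * (Xᴴ * X)).trace.re

noncomputable def csW {m : Type*} [Fintype m] (U V : Matrix m m ℂ) (i j : m) : ℝ :=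
  Complex.normSq ((Uᴴ * V) i j)

noncomputable def csG {m : Type*} [Fintype m] (U V : Matrix m m ℂ) (p q : m → ℝ) (t : ℝ) : ℝ :=
  ∑ i, ∑ j, csW U V i j * (p i * (p i / (q j + t * p i)))

section
variable {m : Type*} [Fintype m] [DecidableEq m]

lemma csL_eq (U V Y : Matrix m m ℂ) (p q : m → ℝ) (t : ℝ) (hU : Uᴴ * U = 1) (hV : Vᴴ * V = 1) :
    csL (U * diagonal (fun i => (p i : ℂ)) * Uᴴ) (V * diagonal (fun i => (q i : ℂ)) * Vᴴ) t
      (V * Y * Uᴴ) = ∑ i, ∑ j, (2 * p i * ((Uᴴ * V) i j * Y j i).re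
        - (q j + t * p i) * Complex.normSq (Y j i)) := by
  have e1 : (U * diagonal (fun i => (p i : ℂ)) * Uᴴ * (V * Y * Uᴴ)).trace
      = (diagonal (fun i => (p i : ℂ)) * ((Uᴴ * V) * Y)).trace := by
    rw [show U * diagonal (fun i => (p i : ℂ)) * Uᴴ * (V * Y * Uᴴ)
      = U * (diagonal (fun i => (p i : ℂ)) * (Uᴴ * V * Y)) * Uᴴ by simp only [Matrix.mul_assoc]]
    rw [Matrix.trace_mul_comm, ← Matrix.mul_assoc, hU, Matrix.one_mul]
  have e2 : (V * diagonal (fun i => (q i : ℂ)) * Vᴴ * ((V * Y * Uᴴ) * (V * Y * Uᴴ)ᴴ)).trace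
      = (diagonal (fun i => (q i : ℂ)) * (Y * Yᴴ)).trace := by
    rw [show V * diagonal (fun i => (q i : ℂ)) * Vᴴ * ((V * Y * Uᴴ) * (V * Y * Uᴴ)ᴴ)
      = V * (diagonal (fun i => (q i : ℂ)) * ((Vᴴ * V) * Y * (Uᴴ * U) * Yᴴ)) * Vᴴ by
        simp only [Matrix.mul_assoc, conjTranspose_mul, conjTranspose_conjTranspose]]
    rw [Matrix.trace_mul_comm, ← Matrix.mul_assoc, hV, hU, Matrix.one_mul, Matrix.one_mul,
      Matrix.mul_one]
  have e3 : (U * diagonal (fun i => (p i : ℂ)) * Uᴴ * ((V * Y * Uᴴ)ᴴ * (V * Y * Uᴴ))).trace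
      = (diagonal (fun i => (p i : ℂ)) * (Yᴴ * Y)).trace := by
    rw [show U * diagonal (fun i => (p i : ℂ)) * Uᴴ * ((V * Y * Uᴴ)ᴴ * (V * Y * Uᴴ))
      = U * (diagonal (fun i => (p i : ℂ)) * ((Uᴴ * U) * Yᴴ * (Vᴴ * V) * Y)) * Uᴴ by
        simp only [Matrix.mul_assoc, conjTranspose_mul, conjTranspose_conjTranspose]]
    rw [Matrix.trace_mul_comm, ← Matrix.mul_assoc, hV, hU, Matrix.one_mul, Matrix.one_mul,
      Matrix.mul_one]
  unfold csL
  rw [e1, e2, e3]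
  have f1 : (diagonal (fun i => (p i : ℂ)) * ((Uᴴ * V) * Y)).trace.re
      = ∑ i, ∑ j, p i * ((Uᴴ * V) i j * Y j i).re := by
    simp only [Matrix.trace, diag_apply, diagonal_mul, Complex.re_sum]
    refine Finset.sum_congr rfl fun i _ => ?_
    rw [Matrix.mul_apply, Complex.re_ofReal_mul, Complex.re_sum, Finset.mul_sum]
  have f2 : (diagonal (fun i => (q i : ℂ)) * (Y * Yᴴ)).trace.re
      = ∑ i, ∑ j, q j * Complex.normSq (Y j i) := by
    simp only [Matrix.trace, diag_apply, diagonal_mul, Complex.re_sum]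
    rw [Finset.sum_comm]
    refine Finset.sum_congr rfl fun i _ => ?_
    rw [Matrix.mul_apply, Complex.re_ofReal_mul, Complex.re_sum, Finset.mul_sum]
    refine Finset.sum_congr rfl fun j _ => ?_
    simp [Complex.normSq_apply]
  have f3 : (diagonal (fun i => (p i : ℂ)) * (Yᴴ * Y)).trace.re
      = ∑ i, ∑ j, p i * Complex.normSq (Y j i) := by
    simp only [Matrix.trace, diag_apply, diagonal_mul, Complex.re_sum]
    refine Finset.sum_congr rfl fun i _ => ?_
    rw [Matrix.mul_apply, Complex.re_ofReal_mul, Complex.re_sum, Finset.mul_sum]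
    refine Finset.sum_congr rfl fun j _ => ?_
    simp [Complex.normSq_apply]
  rw [f1, f2, f3]
  simp only [Finset.mul_sum, ← Finset.sum_sub_distrib]
  refine Finset.sum_congr rfl fun i _ => Finset.sum_congr rfl fun j _ => ?_
  ring

lemma csL_le (U V X : Matrix m m ℂ) (p q : m → ℝ) (t : ℝ) (hU : Uᴴ * U = 1) (hV : Vᴴ * V = 1)
    (hU' : U * Uᴴ = 1) (hV' : V * Vᴴ = 1) (hp : ∀ i, 0 ≤ p i) (hq : ∀ i, 0 < q i) (ht : 0 ≤ t) :
    csL (U * diagonal (fun i => (p i : ℂ)) * Uᴴ) (V * diagonal (fun i => (q i : ℂ)) * Vᴴ) t X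
      ≤ csG U V p q t := by
  have hX : X = V * (Vᴴ * X * U) * Uᴴ := by
    rw [show V * (Vᴴ * X * U) * Uᴴ = (V * Vᴴ) * X * (U * Uᴴ) by simp only [Matrix.mul_assoc]]
    rw [hU', hV']; simp
  rw [hX, csL_eq U V _ p q t hU hV]
  refine Finset.sum_le_sum fun i _ => Finset.sum_le_sum fun j _ => ?_
  exact cs_scalar_le _ _ (by have := mul_nonneg ht (hp i); have := hq j; linarith) _ _

lemma csL_attain (U V : Matrix m m ℂ) (p q : m → ℝ) (t : ℝ) (hU : Uᴴ * U = 1) (hV : Vᴴ * V = 1)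
    (hp : ∀ i, 0 ≤ p i) (hq : ∀ i, 0 < q i) (ht : 0 ≤ t) :
    ∃ X, csL (U * diagonal (fun i => (p i : ℂ)) * Uᴴ) (V * diagonal (fun i => (q i : ℂ)) * Vᴴ) t X
      = csG U V p q t := by
  refine ⟨V * (Matrix.of fun j i => ((p i / (q j + t * p i) : ℝ) : ℂ) * star ((Uᴴ * V) i j)) * Uᴴ,
    ?_⟩
  rw [csL_eq U V _ p q t hU hV]
  refine Finset.sum_congr rfl fun i _ => Finset.sum_congr rfl fun j _ => ?_
  exact cs_scalar_eq _ _ (by have := mul_nonneg ht (hp i); have := hq j; linarith) _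

lemma csW_row (U V : Matrix m m ℂ) (hU : Uᴴ * U = 1) (hV : V * Vᴴ = 1) (i : m) :
    ∑ j, csW U V i j = 1 := by
  have h : (Uᴴ * V) * (Uᴴ * V)ᴴ = 1 := by
    rw [conjTranspose_mul, conjTranspose_conjTranspose,
      show Uᴴ * V * (Vᴴ * U) = Uᴴ * (V * Vᴴ) * U by simp only [Matrix.mul_assoc], hV,
      Matrix.mul_one, hU]
  have h2 := congrArg Complex.re (congrFun (congrFun h i) i)
  rw [Matrix.mul_apply, Complex.re_sum] at h2
  simp only [Matrix.one_apply_eq, Complex.one_re] at h2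
  rw [← h2]
  refine Finset.sum_congr rfl fun j _ => ?_
  simp [csW, Complex.normSq_apply]

/-- The truncated relative entropy. -/
noncomputable def csK {m : Type*} [Fintype m] (U V : Matrix m m ℂ) (p q : m → ℝ) (t : ℝ) : ℝ :=
  ∑ i, ∑ j, csW U V i j * (p i * (Real.log (q j + t * p i) - Real.log (q j)))

lemma csK_deriv (U V : Matrix m m ℂ) (p q : m → ℝ) (t : ℝ)
    (hp : ∀ i, 0 ≤ p i) (hq : ∀ i, 0 < q i) (ht : 0 ≤ t) :
    HasDerivAt (csK U V p q) (csG U V p q t) t := by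
  unfold csK csG
  refine HasDerivAt.fun_sum fun i _ => HasDerivAt.fun_sum fun j _ => ?_
  refine HasDerivAt.const_mul _ (HasDerivAt.const_mul _ ?_)
  refine HasDerivAt.sub_const _ ?_
  have : HasDerivAt (fun t => q j + t * p i) (p i) t := by
    simpa using ((hasDerivAt_id t).mul_const (p i)).const_add (q j)
  exact this.log (by have := mul_nonneg ht (hp i); have := hq j; linarith)

lemma csK_zero (U V : Matrix m m ℂ) (p q : m → ℝ) : csK U V p q 0 = 0 := by
  simp [csK]

/-- relative entropy in spectral form -/
noncomputable def csD {m : Type*} [Fintype m] (U V : Matrix m m ℂ) (p q : m → ℝ) : ℝ :=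
  ∑ i, p i * Real.log (p i) - ∑ i, ∑ j, csW U V i j * (p i * Real.log (q j))

lemma csK_tendsto (U V : Matrix m m ℂ) (p q : m → ℝ) (hU : Uᴴ * U = 1) (hV : V * Vᴴ = 1)
    (hp : ∀ i, 0 ≤ p i) (hq : ∀ i, 0 < q i) :
    Filter.Tendsto (fun t => csK U V p q t - (∑ i, p i) * Real.log t) Filter.atTop
      (nhds (csD U V p q)) := by
  have h1 : csD U V p q = ∑ i, ∑ j, csW U V i j * (p i * (Real.log (p i) - Real.log (q j))) := by
    unfold csD
    simp only [mul_sub, Finset.sum_sub_distrib]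
    congr 1
    refine Finset.sum_congr rfl fun i _ => ?_
    rw [← Finset.sum_mul, csW_row U V hU hV, one_mul]
  have h2 : ∀ t, csK U V p q t - (∑ i, p i) * Real.log t
      = ∑ i, ∑ j, csW U V i j * (p i * (Real.log (q j + t * p i) - Real.log t - Real.log (q j))) := by
    intro t
    unfold csK
    rw [Finset.sum_mul, ← Finset.sum_sub_distrib]
    refine Finset.sum_congr rfl fun i _ => ?_
    have : p i * Real.log t = ∑ j, csW U V i j * (p i * Real.log t) := by
      rw [← Finset.sum_mul, csW_row U V hU hV, one_mul]
    rw [this, ← Finset.sum_sub_distrib]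
    refine Finset.sum_congr rfl fun j _ => ?_
    ring
  rw [h1]
  simp only [h2]
  refine tendsto_finsetSum _ fun i _ => tendsto_finsetSum _ fun j _ => ?_
  refine Filter.Tendsto.const_mul _ ?_
  rcases (hp i).eq_or_lt with h0 | h0
  · simp [← h0]
  refine Filter.Tendsto.const_mul _ (Filter.Tendsto.sub_const ?_ _)
  have h3 : Filter.Tendsto (fun t : ℝ => Real.log (q j * t⁻¹ + p i)) Filter.atTop
      (nhds (Real.log (p i))) := by
    refine Filter.Tendsto.log ?_ h0.ne'
    simpa using (tendsto_inv_atTop_zero.const_mul (q j)).add_const (p i)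
  refine h3.congr' ?_
  filter_upwards [Filter.eventually_gt_atTop (0:ℝ)] with t ht
  rw [← Real.log_div (by have := mul_pos ht h0; have := hq j; positivity) ht.ne']
  congr 1
  field_simp

end

lemma cs_dpi {m k : Type*} [Fintype m] [DecidableEq m] [Fintype k] [DecidableEq k]
    (U V : Matrix m m ℂ) (p q : m → ℝ) (U' V' : Matrix k k ℂ) (p' q' : k → ℝ)
    (hU : Uᴴ * U = 1) (hV : Vᴴ * V = 1) (hU2 : U * Uᴴ = 1) (hV2 : V * Vᴴ = 1)
    (hp : ∀ i, 0 ≤ p i) (hq : ∀ i, 0 < q i)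
    (hU' : U'ᴴ * U' = 1) (hV' : V'ᴴ * V' = 1) (hV2' : V' * V'ᴴ = 1)
    (hp' : ∀ i, 0 ≤ p' i) (hq' : ∀ i, 0 < q' i)
    (φ : Matrix k k ℂ → Matrix m m ℂ)
    (h1 : ∀ X, φ (X * Xᴴ) = φ X * (φ X)ᴴ) (h2 : ∀ X, φ (Xᴴ * X) = (φ X)ᴴ * φ X)
    (hρ : ∀ X, (U * diagonal (fun i => (p i : ℂ)) * Uᴴ * φ X).trace
      = (U' * diagonal (fun i => (p' i : ℂ)) * U'ᴴ * X).trace)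
    (hσ : ∀ X, (V * diagonal (fun i => (q i : ℂ)) * Vᴴ * φ X).trace
      = (V' * diagonal (fun i => (q' i : ℂ)) * V'ᴴ * X).trace)
    (hs : ∑ i, p i = ∑ i, p' i) :
    csD U' V' p' q' ≤ csD U V p q := by
  have hG : ∀ t, 0 ≤ t → csG U' V' p' q' t ≤ csG U V p q t := by
    intro t ht
    obtain ⟨X, hX⟩ := csL_attain U' V' p' q' t hU' hV' hp' hq' ht
    rw [← hX]
    refine le_trans (le_of_eq ?_) (csL_le U V (φ X) p q t hU hV hU2 hV2 hp hq ht)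
    unfold csL
    rw [← h1, ← h2, hρ, hρ, hσ]
  have hK : ∀ t, 0 ≤ t → csK U' V' p' q' t ≤ csK U V p q t := by
    intro t ht
    have hm : MonotoneOn (fun t => csK U V p q t - csK U' V' p' q' t) (Set.Ici 0) := by
      have hd : ∀ t, 0 ≤ t → HasDerivAt (fun t => csK U V p q t - csK U' V' p' q' t)
          (csG U V p q t - csG U' V' p' q' t) t := fun t ht =>
        (csK_deriv U V p q t hp hq ht).sub (csK_deriv U' V' p' q' t hp' hq' ht)
      refine monotoneOn_of_deriv_nonneg (convex_Ici 0) ?_ ?_ ?_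
      · exact fun x hx => (hd x hx).continuousAt.continuousWithinAt
      · intro x hx
        rw [interior_Ici] at hx
        exact (hd x hx.le).differentiableAt.differentiableWithinAt
      · intro x hx
        rw [interior_Ici] at hx
        rw [(hd x hx.le).deriv]
        linarith [hG x hx.le]
    have := hm (Set.mem_Ici.2 le_rfl) (Set.mem_Ici.2 ht) ht
    simp only [csK_zero] at this
    linarith
  refine le_of_tendsto_of_tendsto (csK_tendsto U' V' p' q' hU' hV2' hp' hq')
    (csK_tendsto U V p q hU hV2 hp hq) ?_
  filter_upwards [Filter.eventually_ge_atTop (0:ℝ)] with t ht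
  rw [hs]
  linarith [hK t ht]


lemma cs_cross {m : Type*} [Fintype m] [DecidableEq m] (U V : Matrix m m ℂ) (p f : m → ℝ) :
    ∑ i, ∑ j, csW U V i j * (p i * f j)
      = (U * diagonal (fun i => (p i : ℂ)) * Uᴴ * (V * diagonal (fun i => (f i : ℂ)) * Vᴴ)).trace.re := by
  have : (U * diagonal (fun i => (p i : ℂ)) * Uᴴ * (V * diagonal (fun i => (f i : ℂ)) * Vᴴ)).trace
      = (diagonal (fun i => (p i : ℂ)) * ((Uᴴ * V) * (diagonal (fun i => (f i : ℂ)) * (Uᴴ * V)ᴴ))).trace := by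
    rw [show U * diagonal (fun i => (p i : ℂ)) * Uᴴ * (V * diagonal (fun i => (f i : ℂ)) * Vᴴ)
      = U * (diagonal (fun i => (p i : ℂ)) * Uᴴ * (V * diagonal (fun i => (f i : ℂ)) * Vᴴ)) by
        simp only [Matrix.mul_assoc]]
    rw [Matrix.trace_mul_comm]
    simp only [Matrix.mul_assoc, conjTranspose_mul, conjTranspose_conjTranspose]
  rw [this]
  simp only [Matrix.trace, diag_apply, diagonal_mul, Complex.re_sum]
  refine Finset.sum_congr rfl fun i _ => ?_
  rw [Matrix.mul_apply, Complex.re_ofReal_mul, Complex.re_sum, Finset.mul_sum]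
  refine Finset.sum_congr rfl fun j _ => ?_
  rw [diagonal_mul, conjTranspose_apply]
  simp [csW, Complex.normSq_apply]
  ring

section
variable {a b c : Type*} [Fintype a] [Fintype b] [Fintype c] [DecidableEq a] [DecidableEq b]
  [DecidableEq c]

open scoped Kronecker

/-- The embedding `X ↦ X ⊗ 1`. -/
def csPhi (X : Matrix (a × b) (a × b) ℂ) : Matrix (a × b × c) (a × b × c) ℂ :=
  (X ⊗ₖ (1 : Matrix c c ℂ)).submatrix (Equiv.prodAssoc a b c).symm (Equiv.prodAssoc a b c).symm

lemma csPhi_mul (X Y : Matrix (a × b) (a × b) ℂ) :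
    (csPhi (X * Y) : Matrix (a × b × c) (a × b × c) ℂ) = csPhi X * csPhi Y := by
  unfold csPhi
  rw [submatrix_mul_equiv, ← mul_kronecker_mul, Matrix.one_mul]

lemma csPhi_star (X : Matrix (a × b) (a × b) ℂ) :
    (csPhi Xᴴ : Matrix (a × b × c) (a × b × c) ℂ) = (csPhi X)ᴴ := by
  unfold csPhi
  rw [conjTranspose_submatrix, conjTranspose_kronecker, conjTranspose_one]

lemma csPhi_apply (X : Matrix (a × b) (a × b) ℂ) (i j : a) (k l : b) (x y : c) :
    (csPhi X : Matrix (a × b × c) (a × b × c) ℂ) (i, k, x) (j, l, y)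
      = if x = y then X (i, k) (j, l) else 0 := by
  simp [csPhi, Matrix.one_apply]

lemma csPhi_trace (R : Matrix (a × b × c) (a × b × c) ℂ) (X : Matrix (a × b) (a × b) ℂ) :
    (R * csPhi X).trace
      = ((Matrix.of fun x y : a × b => ∑ k : c, R (x.1, x.2, k) (y.1, y.2, k)) * X).trace := by
  simp only [Matrix.trace, diag_apply, Matrix.mul_apply, Fintype.sum_prod_type, csPhi_apply,
    of_apply, mul_ite, mul_zero, Finset.sum_ite_eq, Finset.sum_ite_eq', Finset.mem_univ, if_true,
    Finset.sum_mul]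
  refine Finset.sum_congr rfl fun i _ => Finset.sum_congr rfl fun j _ => ?_
  rw [Finset.sum_comm]
  refine Finset.sum_congr rfl fun k _ => ?_
  rw [Finset.sum_comm]

lemma cs_one_kron_trace {x : Type*} [Fintype x] [DecidableEq x]
    (R : Matrix (a × x) (a × x) ℂ) (T : Matrix x x ℂ) :
    (R * ((1 : Matrix a a ℂ) ⊗ₖ T)).trace
      = ((Matrix.of fun y z : x => ∑ i : a, R (i, y) (i, z)) * T).trace := by
  simp only [Matrix.trace, diag_apply, Matrix.mul_apply, Fintype.sum_prod_type, of_apply,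
    kronecker_apply, Matrix.one_apply, ite_mul, one_mul, zero_mul, mul_ite, mul_zero,
    Finset.sum_mul]
  rw [Finset.sum_comm]
  refine Finset.sum_congr rfl fun j _ => ?_
  have : ∀ i : a, ∑ k : a, ∑ l : x, (if k = i then R (i, j) (k, l) * T l j else 0)
      = ∑ l : x, R (i, j) (i, l) * T l j := by
    intro i
    rw [Finset.sum_comm]
    simp
  simp only [this]
  rw [Finset.sum_comm]

lemma cs_kron_diag {x : Type*} [Fintype x] [DecidableEq x] (W : Matrix x x ℂ) (f : x → ℝ) :
    ((1 : Matrix a a ℂ) ⊗ₖ W) * diagonal (fun i : a × x => (f i.2 : ℂ))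
      * ((1 : Matrix a a ℂ) ⊗ₖ W)ᴴ
      = (1 : Matrix a a ℂ) ⊗ₖ (W * diagonal (fun i => (f i : ℂ)) * Wᴴ) := by
  have h : diagonal (fun i : a × x => (f i.2 : ℂ))
      = (1 : Matrix a a ℂ) ⊗ₖ diagonal (fun i => (f i : ℂ)) := by
    rw [← diagonal_one, diagonal_kronecker_diagonal]
    simp
  rw [h, conjTranspose_kronecker, conjTranspose_one, ← mul_kronecker_mul, ← mul_kronecker_mul]
  simp

lemma cs_kron_unitary {x : Type*} [Fintype x] [DecidableEq x] (W : Matrix x x ℂ)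
    (h : W * Wᴴ = 1) : ((1 : Matrix a a ℂ) ⊗ₖ W) * ((1 : Matrix a a ℂ) ⊗ₖ W)ᴴ = 1 := by
  rw [conjTranspose_kronecker, conjTranspose_one, ← mul_kronecker_mul, h]
  simp

lemma cs_kron_unitary' {x : Type*} [Fintype x] [DecidableEq x] (W : Matrix x x ℂ)
    (h : Wᴴ * W = 1) : ((1 : Matrix a a ℂ) ⊗ₖ W)ᴴ * ((1 : Matrix a a ℂ) ⊗ₖ W) = 1 := by
  rw [conjTranspose_kronecker, conjTranspose_one, ← mul_kronecker_mul, h]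
  simp

lemma cs_shift {x : Type*} [Fintype x] [DecidableEq x] (W : Matrix x x ℂ) (h : W * Wᴴ = 1)
    (r : x → ℝ) (ε : ℝ) :
    W * diagonal (fun i => ((r i + ε : ℝ) : ℂ)) * Wᴴ
      = W * diagonal (fun i => (r i : ℂ)) * Wᴴ + (ε : ℂ) • (1 : Matrix x x ℂ) := by
  have : diagonal (fun i => ((r i + ε : ℝ) : ℂ))
      = diagonal (fun i => (r i : ℂ)) + (ε : ℂ) • (1 : Matrix x x ℂ) := by
    ext i j
    by_cases hij : i = j <;> simp [hij]
  rw [this, Matrix.mul_add, Matrix.add_mul]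
  simp [h]

/-- the relative entropy of `ρ` and `1 ⊗ (ρ_x + ε)` -/
lemma cs_D_eval {x : Type*} [Fintype x] [DecidableEq x] (U : Matrix (a × x) (a × x) ℂ)
    (p : a × x → ℝ) (W : Matrix x x ℂ) (r : x → ℝ) (hW : Wᴴ * W = 1) (ε : ℝ)
    (hr : (Matrix.of fun y z : x => ∑ i : a,
      (U * diagonal (fun i => (p i : ℂ)) * Uᴴ) (i, y) (i, z))
        = W * diagonal (fun i => (r i : ℂ)) * Wᴴ) :
    csD U ((1 : Matrix a a ℂ) ⊗ₖ W) p (fun i => r i.2 + ε)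
      = ∑ i, p i * Real.log (p i) - ∑ k, r k * Real.log (r k + ε) := by
  unfold csD
  congr 1
  rw [cs_cross U _ p (fun i => Real.log (r i.2 + ε)),
    cs_kron_diag W (fun k => Real.log (r k + ε)), cs_one_kron_trace, hr]
  rw [show W * diagonal (fun i => (r i : ℂ)) * Wᴴ *
    (W * diagonal (fun k => ((Real.log (r k + ε) : ℝ) : ℂ)) * Wᴴ)
    = W * (diagonal (fun i => (r i : ℂ)) * (Wᴴ * W) *
      (diagonal (fun k => ((Real.log (r k + ε) : ℝ) : ℂ)))) * Wᴴ by simp only [Matrix.mul_assoc]]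
  rw [Matrix.trace_mul_comm, ← Matrix.mul_assoc, hW, Matrix.one_mul, Matrix.mul_one,
    diagonal_mul_diagonal, trace_diagonal, Complex.re_sum]
  refine Finset.sum_congr rfl fun k _ => ?_
  rw [← Complex.ofReal_mul, Complex.ofReal_re]

lemma cs_tendsto {x : Type*} [Fintype x] (r : x → ℝ) (C : ℝ) :
    Filter.Tendsto (fun ε : ℝ => ∑ k, r k * Real.log (r k + ε * C)) (nhdsWithin 0 (Set.Ioi 0))
      (nhds (∑ k, r k * Real.log (r k))) := by
  refine tendsto_finsetSum _ fun k _ => ?_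
  by_cases h : r k = 0
  · simp [h]
  refine Filter.Tendsto.const_mul _ ?_
  refine Filter.Tendsto.log ?_ h
  have : Filter.Tendsto (fun ε : ℝ => r k + ε * C) (nhds 0) (nhds (r k + 0 * C)) :=
    (Continuous.tendsto (by fun_prop) _)
  simp only [zero_mul, add_zero] at this
  exact this.mono_left nhdsWithin_le_nhds

lemma cs_psd_sum {x y z : Type*} [Fintype x] [Fintype y] [Fintype z] (R : Matrix x x ℂ)
    (hR : R.PosSemidef) (g : z → y → x) :
    (Matrix.of fun u v : y => ∑ i : z, R (g i u) (g i v)).PosSemidef := by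
  have : (Matrix.of fun u v : y => ∑ i : z, R (g i u) (g i v))
      = ∑ i : z, R.submatrix (g i) (g i) := by
    ext u v
    simp [Matrix.sum_apply]
  rw [this]
  exact posSemidef_sum _ fun i _ => hR.submatrix _

/-- Strong subadditivity on a concrete tripartite system. -/
theorem cs_ssa_concrete (R : Matrix (a × b × c) (a × b × c) ℂ) (hR : R.PosSemidef)
    (htr : R.trace = 1) :
    vnEntropy R + vnEntropy (Matrix.of fun x y : b => ∑ i : a × c, R (i.1, x, i.2) (i.1, y, i.2))
      ≤ vnEntropy (Matrix.of fun x y : a × b => ∑ k : c, R (x.1, x.2, k) (y.1, y.2, k))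
        + vnEntropy (Matrix.of fun x y : b × c => ∑ i : a, R (i, x) (i, y)) := by
  set RB := (Matrix.of fun x y : b => ∑ i : a × c, R (i.1, x, i.2) (i.1, y, i.2)) with hRB
  set RAB := (Matrix.of fun x y : a × b => ∑ k : c, R (x.1, x.2, k) (y.1, y.2, k)) with hRAB
  set RBC := (Matrix.of fun x y : b × c => ∑ i : a, R (i, x) (i, y)) with hRBC
  have pB : RB.PosSemidef := cs_psd_sum R hR (fun (i : a × c) (x : b) => (i.1, x, i.2))
  have pAB : RAB.PosSemidef := cs_psd_sum R hR (fun (k : c) (x : a × b) => (x.1, x.2, k))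
  have pBC : RBC.PosSemidef := cs_psd_sum R hR (fun (i : a) (x : b × c) => (i, x))
  have hne : Nonempty c := by
    by_contra h
    rw [not_nonempty_iff] at h
    simp [Matrix.trace] at htr
  have hc : (0:ℝ) < Fintype.card c := by exact_mod_cast Fintype.card_pos
  obtain ⟨U, u1, u2, u3⟩ := cs_spectral hR.1
  obtain ⟨U', u1', u2', u3'⟩ := cs_spectral pAB.1
  obtain ⟨W, w1, w2, w3⟩ := cs_spectral pBC.1
  obtain ⟨W', w1', w2', w3'⟩ := cs_spectral pB.1
  have tAB : ∀ X, (R * csPhi X).trace = (RAB * X).trace := fun X => csPhi_trace R X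
  have hBC_B : (Matrix.of fun x y : b => ∑ k : c, RBC (x, k) (y, k)) = RB := by
    ext x y
    simp only [hRBC, hRB, of_apply, Fintype.sum_prod_type]
    rw [Finset.sum_comm]
  have hAB_B : (Matrix.of fun x y : b => ∑ i : a, RAB (i, x) (i, y)) = RB := by
    ext x y
    simp only [hRAB, hRB, of_apply, Fintype.sum_prod_type]
  have htrAB : RAB.trace = 1 := by
    rw [← htr]
    simp only [hRAB, Matrix.trace, diag_apply, of_apply, Fintype.sum_prod_type]
  have key : ∀ ε : ℝ, 0 < ε →
      (∑ i, pAB.1.eigenvalues i * Real.log (pAB.1.eigenvalues i)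
        - ∑ k, pB.1.eigenvalues k * Real.log (pB.1.eigenvalues k + ε * Fintype.card c))
      ≤ (∑ i, hR.1.eigenvalues i * Real.log (hR.1.eigenvalues i)
        - ∑ k, pBC.1.eigenvalues k * Real.log (pBC.1.eigenvalues k + ε * 1)) := by
    intro ε hε
    rw [mul_one]
    rw [← cs_D_eval U hR.1.eigenvalues W pBC.1.eigenvalues w2 ε (by rw [← u3, ← w3])]
    rw [← cs_D_eval U' pAB.1.eigenvalues W' pB.1.eigenvalues w2' (ε * Fintype.card c)
      (by rw [← u3', ← w3', hAB_B])]
    refine cs_dpi U _ _ _ U' _ _ _ u2 (cs_kron_unitary' W w2) u1 (cs_kron_unitary W w1)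
      (fun i => hR.eigenvalues_nonneg i)
      (fun i => by have := pBC.eigenvalues_nonneg i.2; positivity) u2' (cs_kron_unitary' W' w2')
      (cs_kron_unitary W' w1') (fun i => pAB.eigenvalues_nonneg i)
      (fun i => by have := pB.eigenvalues_nonneg i.2; positivity) csPhi
      (fun X => by rw [csPhi_mul, csPhi_star]) (fun X => by rw [csPhi_mul, csPhi_star])
      (fun X => by rw [← u3, ← u3', tAB]) ?_ ?_
    · intro X
      rw [cs_kron_diag W (fun k => pBC.1.eigenvalues k + ε),
        cs_kron_diag W' (fun k => pB.1.eigenvalues k + ε * Fintype.card c),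
        cs_shift W w1, cs_shift W' w1', ← w3, ← w3', csPhi_trace]
      congr 2
      ext ⟨i, x⟩ ⟨j, y⟩
      have := congrFun (congrFun hBC_B x) y
      simp only [of_apply] at this
      simp only [of_apply, kronecker_apply, ← Finset.mul_sum, Matrix.add_apply,
        Finset.sum_add_distrib, this]
      congr 2
      by_cases hxy : x = y <;> simp [Matrix.one_apply, hxy, mul_comm]
    · rw [cs_sum_eigenvalues hR.1 htr, cs_sum_eigenvalues pAB.1 htrAB]
  have lim := le_of_tendsto_of_tendsto
    ((cs_tendsto pB.1.eigenvalues (Fintype.card c)).const_sub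
      (∑ i, pAB.1.eigenvalues i * Real.log (pAB.1.eigenvalues i)))
    ((cs_tendsto pBC.1.eigenvalues 1).const_sub
      (∑ i, hR.1.eigenvalues i * Real.log (hR.1.eigenvalues i)))
    (by filter_upwards [self_mem_nhdsWithin] with ε hε using key ε hε)
  rw [cs_vnEntropy_eq hR.1, cs_vnEntropy_eq pB.1, cs_vnEntropy_eq pAB.1, cs_vnEntropy_eq pBC.1]
  linarith

end


section
variable {ι : Type*} [Fintype ι] [DecidableEq ι] {dim : ι → ℕ}

/-- Gluing of partial configurations. -/
def csGlue (S : Finset ι) (x : (i : {j : ι // j ∈ S}) → Fin (dim i.1))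
    (z : (i : {j : ι // j ∉ S}) → Fin (dim i.1)) : (i : ι) → Fin (dim i) :=
  fun i => if h : i ∈ S then x ⟨i, h⟩ else z ⟨i, h⟩

lemma csGlue_in (S : Finset ι) (x : (i : {j : ι // j ∈ S}) → Fin (dim i.1))
    (z : (i : {j : ι // j ∉ S}) → Fin (dim i.1)) (i : ι) (h : i ∈ S) :
    csGlue S x z i = x ⟨i, h⟩ := by
  simp [csGlue, h]

lemma csGlue_out (S : Finset ι) (x : (i : {j : ι // j ∈ S}) → Fin (dim i.1))
    (z : (i : {j : ι // j ∉ S}) → Fin (dim i.1)) (i : ι) (h : i ∉ S) :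
    csGlue S x z i = z ⟨i, h⟩ := by
  simp [csGlue, h]

lemma cs_mEnt_equiv (ρ : Matrix ((i : ι) → Fin (dim i)) ((i : ι) → Fin (dim i)) ℂ)
    (hρ : ρ.PosSemidef) (u0 : (i : ι) → Fin (dim i)) (S : Finset ι)
    {s t : Type*} [Fintype s] [Fintype t] [DecidableEq s]
    (e : ((i : ι) → Fin (dim i)) ≃ s × t)
    (h1 : ∀ u v, (e u).1 = (e v).1 ↔ ∀ i ∈ S, u i = v i)
    (h2 : ∀ u v, (e u).2 = (e v).2 ↔ ∀ i, i ∉ S → u i = v i) :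
    mEnt ρ S = vnEntropy (Matrix.of fun x y : s => ∑ z : t, ρ (e.symm (x, z)) (e.symm (y, z))) := by
  let x0 : (i : {j : ι // j ∈ S}) → Fin (dim i.1) := fun i => u0 i.1
  let z0 : (i : {j : ι // j ∉ S}) → Fin (dim i.1) := fun i => u0 i.1
  let f0 : ((i : {j : ι // j ∈ S}) → Fin (dim i.1)) → s := fun x => (e (csGlue S x z0)).1
  let g0 : ((i : {j : ι // j ∉ S}) → Fin (dim i.1)) → t := fun z => (e (csGlue S x0 z)).2
  have hf : Function.Bijective f0 := by
    constructor
    · intro x y hxy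
      have := (h1 _ _).1 hxy
      funext i
      have h3 := this i.1 i.2
      rwa [csGlue_in S _ _ _ i.2, csGlue_in S _ _ _ i.2] at h3
    · intro y
      refine ⟨fun i => e.symm (y, (e u0).2) i.1, ?_⟩
      have : y = (e (e.symm (y, (e u0).2))).1 := by simp
      conv_rhs => rw [this]
      refine (h1 _ _).2 fun i hi => ?_
      rw [csGlue_in S _ _ _ hi]
  have hg : Function.Bijective g0 := by
    constructor
    · intro x y hxy
      have := (h2 _ _).1 hxy
      funext i
      have h3 := this i.1 i.2
      rwa [csGlue_out S _ _ _ i.2, csGlue_out S _ _ _ i.2] at h3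
    · intro y
      refine ⟨fun i => e.symm ((e u0).1, y) i.1, ?_⟩
      have : y = (e (e.symm ((e u0).1, y))).2 := by simp
      conv_rhs => rw [this]
      refine (h2 _ _).2 fun i hi => ?_
      rw [csGlue_out S _ _ _ hi]
  have hglue : ∀ x z, csGlue S x z = e.symm (f0 x, g0 z) := by
    intro x z
    rw [Equiv.eq_symm_apply]
    refine Prod.ext ?_ ?_
    · refine (h1 _ _).2 fun i hi => ?_
      rw [csGlue_in S _ _ _ hi, csGlue_in S _ _ _ hi]
    · refine (h2 _ _).2 fun i hi => ?_
      rw [csGlue_out S _ _ _ hi, csGlue_out S _ _ _ hi]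
  have hH := cs_psd_sum ρ hρ (fun (z : t) (x : s) => e.symm (x, z))
  rw [← cs_vnEntropy_submatrix hH.1 (Equiv.ofBijective f0 hf)]
  unfold mEnt
  congr 1
  ext x y
  have hm : marginal ρ S x y = ∑ z, ρ (csGlue S x z) (csGlue S y z) := rfl
  rw [hm]
  simp only [submatrix_apply, of_apply, Equiv.ofBijective_apply, hglue]
  exact (Equiv.ofBijective g0 hg).sum_comp
    (fun z => ρ (e.symm (f0 x, z)) (e.symm (f0 y, z)))

lemma cs_marginal_psd (ρ : Matrix ((i : ι) → Fin (dim i)) ((i : ι) → Fin (dim i)) ℂ)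
    (hρ : ρ.PosSemidef) (S : Finset ι) : (marginal ρ S).PosSemidef :=
  cs_psd_sum ρ hρ (fun (z : (i : {j : ι // j ∉ S}) → Fin (dim i.1)) x => csGlue S x z)

/-- splitting of configurations -/
def csSplit (S : Finset ι) : ((i : ι) → Fin (dim i)) ≃
    ((i : {j : ι // j ∈ S}) → Fin (dim i.1)) × ((i : {j : ι // j ∉ S}) → Fin (dim i.1)) where
  toFun u := (fun i => u i.1, fun i => u i.1)
  invFun w := csGlue S w.1 w.2
  left_inv u := by
    funext i
    by_cases h : i ∈ S <;> simp [csGlue, h]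
  right_inv w := by
    refine Prod.ext ?_ ?_
    · funext i
      exact csGlue_in S _ _ _ i.2
    · funext i
      exact csGlue_out S _ _ _ i.2

lemma cs_marginal_trace (ρ : Matrix ((i : ι) → Fin (dim i)) ((i : ι) → Fin (dim i)) ℂ)
    (S : Finset ι) : (marginal ρ S).trace = ρ.trace := by
  unfold Matrix.trace
  rw [← (csSplit S).symm.sum_comp, Fintype.sum_prod_type]
  rfl

lemma cs_mEnt_le (ρ : Matrix ((i : ι) → Fin (dim i)) ((i : ι) → Fin (dim i)) ℂ)
    (hρ : ρ.PosSemidef) (htr : ρ.trace = 1) (S : Finset ι) :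
    mEnt ρ S ≤ ∑ i ∈ S, Real.log (dim i) := by
  unfold mEnt
  have h1 := cs_vnEntropy_le (cs_marginal_psd ρ hρ S) (by rw [cs_marginal_trace, htr])
  refine h1.trans ?_
  have hne : Nonempty ((i : ι) → Fin (dim i)) := by
    by_contra h
    rw [not_nonempty_iff] at h
    simp [Matrix.trace] at htr
  obtain ⟨u⟩ := hne
  rw [Fintype.card_pi]
  push_cast
  rw [Real.log_prod]
  · simp only [Fintype.card_fin]
    rw [← Finset.sum_coe_sort S (fun i => Real.log (dim i))]
  · intro i _
    have := (u i.1).pos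
    simp only [Fintype.card_fin]
    positivity

lemma cs_mEnt_empty (ρ : Matrix ((i : ι) → Fin (dim i)) ((i : ι) → Fin (dim i)) ℂ)
    (hρ : ρ.PosSemidef) (htr : ρ.trace = 1) : mEnt ρ ∅ = 0 := by
  have hP := cs_marginal_psd ρ hρ ∅
  have ht : (marginal ρ ∅).trace = 1 := by rw [cs_marginal_trace, htr]
  have hs := cs_sum_eigenvalues hP.1 ht
  unfold mEnt
  rw [cs_vnEntropy_eq hP.1]
  have : IsEmpty {j : ι // j ∈ (∅ : Finset ι)} := ⟨fun i => absurd i.2 (Finset.notMem_empty _)⟩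
  rw [Fintype.sum_unique] at hs ⊢
  rw [hs]
  simp

/-- purity -/
lemma cs_mEnt_compl (ρ : Matrix ((i : ι) → Fin (dim i)) ((i : ι) → Fin (dim i)) ℂ)
    (hρ : ρ.PosSemidef) (htr : ρ.trace = 1) (hr : ρ.rank = 1) (S : Finset ι) :
    mEnt ρ Sᶜ = mEnt ρ S := by
  have hne : Nonempty ((i : ι) → Fin (dim i)) := by
    by_contra h
    rw [not_nonempty_iff] at h
    simp [Matrix.trace] at htr
  obtain ⟨u0⟩ := hne
  -- a vector representing the state
  obtain ⟨v, hv⟩ : ∃ v : ((i : ι) → Fin (dim i)) → ℂ, ∀ x y, ρ x y = v x * star (v y) := by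
    obtain ⟨U, _, _, u3⟩ := cs_spectral hρ.1
    rw [hρ.1.rank_eq_card_non_zero_eigs, Fintype.card_eq_one_iff] at hr
    obtain ⟨⟨j, hj⟩, huniq⟩ := hr
    have hz : ∀ i, i ≠ j → hρ.1.eigenvalues i = 0 := by
      intro i hi
      by_contra h0
      exact hi (congrArg Subtype.val (huniq ⟨i, h0⟩))
    have hsum := cs_sum_eigenvalues hρ.1 htr
    rw [Finset.sum_eq_single j (fun i _ hi => hz i hi) (by simp)] at hsum
    refine ⟨fun x => U x j, fun x y => ?_⟩
    have h4 := congrFun (congrFun u3 x) y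
    rw [h4, Matrix.mul_apply, Finset.sum_eq_single j]
    · rw [mul_diagonal, hsum, conjTranspose_apply]; simp
    · intro i _ hi
      rw [mul_diagonal, hz i hi]; simp
    · simp
  have e1 := cs_mEnt_equiv ρ hρ u0 S (csSplit S)
    (by intro u v; simp [csSplit, funext_iff]) (by intro u v; simp [csSplit, funext_iff])
  have e2 := cs_mEnt_equiv ρ hρ u0 Sᶜ ((csSplit S).trans (Equiv.prodComm _ _))
    (by intro u v; simp [csSplit, funext_iff]) (by intro u v; simp [csSplit, funext_iff])
  rw [e1, e2]
  have := cs_vnEntropy_schmidt (Matrix.of fun x z => v ((csSplit S).symm (x, z)))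
  convert this.symm using 2
  · ext x y
    simp only [hv, Matrix.mul_apply, transpose_apply, conjTranspose_apply, of_apply]
    exact Finset.sum_congr rfl fun i _ => mul_comm _ _
  · ext x y
    simp only [hv, Matrix.mul_apply, conjTranspose_apply, of_apply]

/-- four-fold splitting -/
def csSplit4 (A B C : Finset ι) (hAB : Disjoint A B) (hAC : Disjoint A C) (hBC : Disjoint B C) :
    ((i : ι) → Fin (dim i)) ≃
    ((i : {j : ι // j ∈ A}) → Fin (dim i.1)) × ((i : {j : ι // j ∈ B}) → Fin (dim i.1)) ×
    ((i : {j : ι // j ∈ C}) → Fin (dim i.1)) ×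
    ((i : {j : ι // j ∉ A ∧ j ∉ B ∧ j ∉ C}) → Fin (dim i.1)) where
  toFun u := (fun i => u i.1, fun i => u i.1, fun i => u i.1, fun i => u i.1)
  invFun w := fun i => if hA : i ∈ A then w.1 ⟨i, hA⟩ else if hB : i ∈ B then w.2.1 ⟨i, hB⟩ else
    if hC : i ∈ C then w.2.2.1 ⟨i, hC⟩ else w.2.2.2 ⟨i, hA, hB, hC⟩
  left_inv u := by
    funext i
    by_cases hA : i ∈ A <;> by_cases hB : i ∈ B <;> by_cases hC : i ∈ C <;> simp [hA, hB, hC]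
  right_inv w := by
    refine Prod.ext ?_ (Prod.ext ?_ (Prod.ext ?_ ?_))
    · funext i
      simp [i.2]
    · funext i
      have h1 := Finset.disjoint_right.1 hAB i.2
      simp [i.2, h1]
    · funext i
      have h1 := Finset.disjoint_right.1 hAC i.2
      have h2 := Finset.disjoint_right.1 hBC i.2
      simp [i.2, h1, h2]
    · funext i
      simp [i.2.1, i.2.2.1, i.2.2.2]

/-- Strong subadditivity for marginals. -/
theorem cs_ssa (ρ : Matrix ((i : ι) → Fin (dim i)) ((i : ι) → Fin (dim i)) ℂ)
    (hρ : ρ.PosSemidef) (htr : ρ.trace = 1)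
    (A B C : Finset ι) (hAB : Disjoint A B) (hAC : Disjoint A C) (hBC : Disjoint B C) :
    mEnt ρ (A ∪ B ∪ C) + mEnt ρ B ≤ mEnt ρ (A ∪ B) + mEnt ρ (B ∪ C) := by
  have hne : Nonempty ((i : ι) → Fin (dim i)) := by
    by_contra h
    rw [not_nonempty_iff] at h
    simp [Matrix.trace] at htr
  obtain ⟨u0⟩ := hne
  let a := (i : {j : ι // j ∈ A}) → Fin (dim i.1)
  let b := (i : {j : ι // j ∈ B}) → Fin (dim i.1)
  let c := (i : {j : ι // j ∈ C}) → Fin (dim i.1)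
  let r := (i : {j : ι // j ∉ A ∧ j ∉ B ∧ j ∉ C}) → Fin (dim i.1)
  let E : ((i : ι) → Fin (dim i)) ≃ a × b × c × r := csSplit4 A B C hAB hAC hBC
  have hE1 : ∀ u v, (E u).1 = (E v).1 ↔ ∀ i ∈ A, u i = v i := by
    exact fun u v => ⟨fun h i hi => congrFun h ⟨i, hi⟩, fun h => funext fun i => h i.1 i.2⟩
  have hE2 : ∀ u v, (E u).2.1 = (E v).2.1 ↔ ∀ i ∈ B, u i = v i := by
    exact fun u v => ⟨fun h i hi => congrFun h ⟨i, hi⟩, fun h => funext fun i => h i.1 i.2⟩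
  have hE3 : ∀ u v, (E u).2.2.1 = (E v).2.2.1 ↔ ∀ i ∈ C, u i = v i := by
    exact fun u v => ⟨fun h i hi => congrFun h ⟨i, hi⟩, fun h => funext fun i => h i.1 i.2⟩
  have hE4 : ∀ u v, (E u).2.2.2 = (E v).2.2.2 ↔ ∀ i, i ∉ A ∧ i ∉ B ∧ i ∉ C → u i = v i := by
    exact fun u v => ⟨fun h i hi => congrFun h ⟨i, hi⟩, fun h => funext fun i => h i.1 i.2⟩
  have dAB : ∀ i, i ∈ A → i ∉ B := fun i hi => Finset.disjoint_left.1 hAB hi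
  have dAC : ∀ i, i ∈ A → i ∉ C := fun i hi => Finset.disjoint_left.1 hAC hi
  have dBC : ∀ i, i ∈ B → i ∉ C := fun i hi => Finset.disjoint_left.1 hBC hi
  let s1 : a × b × c × r ≃ (a × b × c) × r :=
    ⟨fun w => ((w.1, w.2.1, w.2.2.1), w.2.2.2), fun w => (w.1.1, w.1.2.1, w.1.2.2, w.2),
      fun _ => rfl, fun _ => rfl⟩
  let s2 : a × b × c × r ≃ b × ((a × c) × r) :=
    ⟨fun w => (w.2.1, (w.1, w.2.2.1), w.2.2.2), fun w => (w.2.1.1, w.1, w.2.1.2, w.2.2),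
      fun _ => rfl, fun _ => rfl⟩
  let s3 : a × b × c × r ≃ (a × b) × (c × r) :=
    ⟨fun w => ((w.1, w.2.1), (w.2.2.1, w.2.2.2)), fun w => (w.1.1, w.1.2, w.2.1, w.2.2),
      fun _ => rfl, fun _ => rfl⟩
  let s4 : a × b × c × r ≃ (b × c) × (a × r) :=
    ⟨fun w => ((w.2.1, w.2.2.1), (w.1, w.2.2.2)), fun w => (w.2.1, w.1.1, w.1.2, w.2.2),
      fun _ => rfl, fun _ => rfl⟩
  have e1 := cs_mEnt_equiv ρ hρ u0 (A ∪ B ∪ C) (E.trans s1)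
    (by
      intro u v
      simp only [Equiv.trans_apply, s1, Equiv.coe_fn_mk, Prod.mk.injEq, hE1, hE2, hE3]
      grind)
    (by
      intro u v
      simp only [Equiv.trans_apply, s1, Equiv.coe_fn_mk, hE4]
      grind)
  have e2 := cs_mEnt_equiv ρ hρ u0 B (E.trans s2)
    (by
      intro u v
      simp only [Equiv.trans_apply, s2, Equiv.coe_fn_mk, hE2])
    (by
      intro u v
      simp only [Equiv.trans_apply, s2, Equiv.coe_fn_mk, Prod.mk.injEq, hE1, hE3, hE4]
      grind)
  have e3 := cs_mEnt_equiv ρ hρ u0 (A ∪ B) (E.trans s3)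
    (by
      intro u v
      simp only [Equiv.trans_apply, s3, Equiv.coe_fn_mk, Prod.mk.injEq, hE1, hE2]
      grind)
    (by
      intro u v
      simp only [Equiv.trans_apply, s3, Equiv.coe_fn_mk, Prod.mk.injEq, hE3, hE4]
      grind)
  have e4 := cs_mEnt_equiv ρ hρ u0 (B ∪ C) (E.trans s4)
    (by
      intro u v
      simp only [Equiv.trans_apply, s4, Equiv.coe_fn_mk, Prod.mk.injEq, hE2, hE3]
      grind)
    (by
      intro u v
      simp only [Equiv.trans_apply, s4, Equiv.coe_fn_mk, Prod.mk.injEq, hE1, hE4]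
      grind)
  let R : Matrix (a × b × c) (a × b × c) ℂ := Matrix.of fun x y =>
    ∑ z : r, ρ ((E.trans s1).symm (x, z)) ((E.trans s1).symm (y, z))
  have hR : R.PosSemidef := cs_psd_sum ρ hρ (fun (z : r) x => (E.trans s1).symm (x, z))
  have hRt : R.trace = 1 := by
    rw [← htr]
    unfold Matrix.trace
    rw [← (E.trans s1).symm.sum_comp]
    exact (Fintype.sum_prod_type (fun w : (a × b × c) × r => ρ.diag ((E.trans s1).symm w))).symm
  have main := cs_ssa_concrete R hR hRt
  rw [e1, e2, e3, e4]
  convert main using 3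
  · ext x y
    simp only [of_apply, R]
    rw [Fintype.sum_prod_type]
    rfl
  · ext x y
    simp only [of_apply, R]
    rw [Fintype.sum_prod_type]
    rfl
  · ext x y
    simp only [of_apply, R]
    rw [Fintype.sum_prod_type]
    rfl

end


section
variable {n : ℕ}

lemma cs_perm_card (g : Finset (Fin n) → ℝ) (K L : Finset (Fin n)) (h : K.card = L.card) :
    ∑ π : Equiv.Perm (Fin n), g (K.image π) = ∑ π : Equiv.Perm (Fin n), g (L.image π) := by
  let e : {x // x ∈ K} ≃ {x // x ∈ L} := Finset.equivOfCardEq h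
  let τ : Equiv.Perm (Fin n) := e.extendSubtype
  have hτ : K.image τ = L := by
    refine Finset.eq_of_subset_of_card_le ?_ ?_
    · intro x hx
      obtain ⟨y, hy, rfl⟩ := Finset.mem_image.1 hx
      exact e.extendSubtype_mem y hy
    · rw [Finset.card_image_of_injective _ τ.injective, h]
  rw [← hτ]
  refine Eq.trans (Equiv.sum_comp (Equiv.mulRight τ) (fun π => g (K.image π))).symm ?_
  refine Finset.sum_congr rfl fun π _ => ?_
  rw [Finset.image_image]
  rfl

lemma cs_perm_avg (g : Finset (Fin n) → ℝ) (K : Finset (Fin n)) :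
    (Fintype.card (Equiv.Perm (Fin n)) : ℝ) * ∑ J ∈ Finset.powersetCard K.card Finset.univ, g J
      = (n.choose K.card : ℝ) * ∑ π : Equiv.Perm (Fin n), g (K.image π) := by
  have h1 : ∀ π : Equiv.Perm (Fin n), ∑ J ∈ Finset.powersetCard K.card Finset.univ, g (J.image π)
      = ∑ J ∈ Finset.powersetCard K.card Finset.univ, g J := by
    intro π
    refine Finset.sum_bij' (fun J _ => J.image π) (fun J _ => J.image π.symm) ?_ ?_ ?_ ?_ ?_
    · intro J hJ
      rw [Finset.mem_powersetCard] at hJ ⊢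
      exact ⟨Finset.subset_univ _, by rw [Finset.card_image_of_injective _ π.injective, hJ.2]⟩
    · intro J hJ
      rw [Finset.mem_powersetCard] at hJ ⊢
      exact ⟨Finset.subset_univ _, by rw [Finset.card_image_of_injective _ π.symm.injective, hJ.2]⟩
    · intro J _
      simp [Finset.image_image]
    · intro J _
      simp [Finset.image_image]
    · intro J _
      rfl
  have h2 : ∑ π : Equiv.Perm (Fin n), ∑ J ∈ Finset.powersetCard K.card Finset.univ, g (J.image π)
      = ∑ J ∈ Finset.powersetCard K.card (Finset.univ : Finset (Fin n)),
        ∑ π : Equiv.Perm (Fin n), g (K.image π) := by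
    rw [Finset.sum_comm]
    refine Finset.sum_congr rfl fun J hJ => ?_
    exact cs_perm_card g J K (Finset.mem_powersetCard.1 hJ).2
  rw [Finset.sum_congr rfl (fun π _ => h1 π)] at h2
  simpa [Finset.card_powersetCard] using h2

/-- initial segment -/
def csSeg (n k : ℕ) : Finset (Fin n) := Finset.univ.filter (fun i => i.val < k)

lemma csSeg_card (k : ℕ) (hk : k ≤ n) : (csSeg n k).card = k := by
  unfold csSeg
  rw [Fin.card_filter_val_lt]
  omega

lemma cs_concave (g : Finset (Fin n) → ℝ)
    (hg : ∀ (S : Finset (Fin n)) (i j : Fin n), i ∉ S → j ∉ S → i ≠ j →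
      g (insert i (insert j S)) + g S ≤ g (insert i S) + g (insert j S))
    (k : ℕ) (hk : k + 2 ≤ n) :
    (∑ π : Equiv.Perm (Fin n), g ((csSeg n (k + 2)).image π))
      + (∑ π : Equiv.Perm (Fin n), g ((csSeg n k).image π))
      ≤ 2 * ∑ π : Equiv.Perm (Fin n), g ((csSeg n (k + 1)).image π) := by
  let i : Fin n := ⟨k, by omega⟩
  let j : Fin n := ⟨k + 1, by omega⟩
  have hi : i ∉ csSeg n k := by simp [csSeg, i]
  have hj : j ∉ csSeg n k := by simp [csSeg, j]
  have hij : i ≠ j := by simp [i, j]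
  have c0 : (csSeg n k).card = k := csSeg_card k (by omega)
  have e1 := cs_perm_card g (insert i (csSeg n k)) (csSeg n (k + 1))
    (by rw [Finset.card_insert_of_notMem hi, c0, csSeg_card _ (by omega)])
  have e2 := cs_perm_card g (insert j (csSeg n k)) (csSeg n (k + 1))
    (by rw [Finset.card_insert_of_notMem hj, c0, csSeg_card _ (by omega)])
  have e3 := cs_perm_card g (insert i (insert j (csSeg n k))) (csSeg n (k + 2))
    (by rw [Finset.card_insert_of_notMem (by simp [hi, hij]), Finset.card_insert_of_notMem hj, c0,
          csSeg_card _ (by omega)])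
  rw [← e3, two_mul]
  nth_rewrite 1 [← e1]
  rw [← e2, ← Finset.sum_add_distrib, ← Finset.sum_add_distrib]
  refine Finset.sum_le_sum fun π _ => ?_
  simp only [Finset.image_insert]
  refine hg _ _ _ ?_ ?_ ?_
  · rw [Finset.mem_image]; rintro ⟨x, hx, hxi⟩; exact hi (π.injective hxi ▸ hx)
  · rw [Finset.mem_image]; rintro ⟨x, hx, hxi⟩; exact hj (π.injective hxi ▸ hx)
  · exact fun h => hij (π.injective h)

lemma cs_seq (u : ℕ → ℝ) (m : ℕ) (hm : 1 ≤ m) (hmn : 2 * m ≤ n)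
    (hu : ∀ k, k + 2 ≤ n → u (k + 2) + u k ≤ 2 * u (k + 1)) :
    (m : ℝ) * (u (n - m) - u m) ≤ ((n : ℝ) - 2 * m) * (u m - u 0) := by
  have hanti : ∀ k j, k + j + 1 ≤ n → u (k + j + 1) - u (k + j) ≤ u (k + 1) - u k := by
    intro k j
    induction j with
    | zero => intro _; simp
    | succ j ih =>
      intro h
      have h1 := ih (by omega)
      have h2 := hu (k + j) (by omega)
      rw [show k + (j + 1) + 1 = k + j + 2 by ring, show k + (j + 1) = k + j + 1 by ring]
      linarith
  obtain ⟨l, rfl⟩ : ∃ l, m = l + 1 := ⟨m - 1, by omega⟩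
  have hA : ∀ j, l + 1 + j ≤ n → u (l + 1 + j) - u (l + 1) ≤ j * (u (l + 1) - u l) := by
    intro j
    induction j with
    | zero => intro _; simp
    | succ j ih =>
      intro h
      have h1 := ih (by omega)
      have h2 := hanti l (j + 1) (by omega)
      rw [show l + (j + 1) + 1 = l + 1 + (j + 1) by ring,
        show l + (j + 1) = l + 1 + j by ring] at h2
      push_cast
      linarith
  have hB : ∀ j, j ≤ l + 1 → j * (u (l + 1) - u l) ≤ u j - u 0 := by
    intro j
    induction j with
    | zero => intro _; simp
    | succ j ih =>
      intro h
      have h1 := ih (by omega)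
      have h2 := hanti j (l - j) (by omega)
      rw [show j + (l - j) = l by omega] at h2
      push_cast
      linarith
  have h1 := hA (n - 2 * (l + 1)) (by omega)
  have h2 := hB (l + 1) le_rfl
  rw [show l + 1 + (n - 2 * (l + 1)) = n - (l + 1) by omega, Nat.cast_sub hmn] at h1
  push_cast at *
  have h3 : (0:ℝ) ≤ (n : ℝ) - 2 * (l + 1) := by
    have : ((2 * (l + 1) : ℕ) : ℝ) ≤ n := by exact_mod_cast hmn
    push_cast at this
    linarith
  have h4 := mul_le_mul_of_nonneg_left h2 h3
  have h5 := mul_le_mul_of_nonneg_left h1 (show (0:ℝ) ≤ (l:ℝ) + 1 by positivity)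
  linarith

/-- the purely combinatorial part -/
lemma cs_combi (m : ℕ) (hm : 1 ≤ m) (hmn : 2 * m < n)
    (h : Finset (Fin n ⊕ Fin 3) → ℝ) (h0 : h ∅ = 0)
    (hc : ∀ S, h Sᶜ = h S)
    (hssa : ∀ A B C, Disjoint A B → Disjoint A C → Disjoint B C →
      h (A ∪ B ∪ C) + h B ≤ h (A ∪ B) + h (B ∪ C))
    (hdec : ∀ J : Finset (Fin n), J.card = m →
      h (Jᶜ.image Sum.inl ∪ {Sum.inr 2}) = h {Sum.inr 0} + h ({Sum.inr 1} ∪ J.image Sum.inl)) :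
    h {Sum.inr 0} - h {Sum.inr 2} ≤ ((n : ℝ) - 2 * m) * ((1 / (m : ℝ)) *
      ((∑ J ∈ Finset.powersetCard m (Finset.univ : Finset (Fin n)), h (J.image Sum.inl))
        / (n.choose m : ℝ))) := by
  have hsub : ∀ A C, Disjoint A C → h (A ∪ C) ≤ h A + h C := by
    intro A C hAC
    have := hssa A ∅ C (by simp) hAC (by simp)
    simp only [Finset.union_empty, Finset.empty_union, h0] at this
    linarith
  have hdisj : ∀ (Z : Finset (Fin 3)) (J : Finset (Fin n)),
      Disjoint (Z.image Sum.inr : Finset (Fin n ⊕ Fin 3)) (J.image Sum.inl) := by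
    intro Z J
    rw [Finset.disjoint_left]
    simp
  let g : Finset (Fin 3) → Finset (Fin n) → ℝ := fun Z J => h (Z.image Sum.inr ∪ J.image Sum.inl)
  have hgsub : ∀ (Z : Finset (Fin 3)) (S : Finset (Fin n)) (i j : Fin n), i ∉ S → j ∉ S → i ≠ j →
      g Z (insert i (insert j S)) + g Z S ≤ g Z (insert i S) + g Z (insert j S) := by
    intro Z S i j hi hj hij
    have := hssa {Sum.inl i} (Z.image Sum.inr ∪ S.image Sum.inl) {Sum.inl j}
      (by simp [hi]) (by simp [hij]) (by simp [hj])
    simp only [g]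
    convert this using 3
    · ext x; simp
    · ext x; simp
    · ext x; simp
  let u : Finset (Fin 3) → ℕ → ℝ := fun Z k => ∑ π : Equiv.Perm (Fin n), g Z ((csSeg n k).image π)
  have hconc : ∀ Z, (m : ℝ) * (u Z (n - m) - u Z m) ≤ ((n : ℝ) - 2 * m) * (u Z m - u Z 0) :=
    fun Z => cs_seq (u Z) m hm hmn.le (cs_concave (g Z) (hgsub Z))
  let N : ℝ := Fintype.card (Equiv.Perm (Fin n))
  have hN : 0 < N := by
    have : 0 < Fintype.card (Equiv.Perm (Fin n)) := Fintype.card_pos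
    show (0:ℝ) < (Fintype.card (Equiv.Perm (Fin n)) : ℝ)
    exact_mod_cast this
  have hconst : ∀ x : ℝ, ∑ _π : Equiv.Perm (Fin n), x = N * x := by
    intro x; simp [N]
  have hseg0 : csSeg n 0 = ∅ := by simp [csSeg]
  have hu0 : ∀ Z, u Z 0 = N * h (Z.image Sum.inr) := by
    intro Z
    simp only [u, g, hseg0, Finset.image_empty, Finset.union_empty]
    exact hconst _
  have hcm : (csSeg n m).card = m := csSeg_card m (by omega)
  have hflip : ∀ Z, u Z (n - m) = ∑ π : Equiv.Perm (Fin n), g Z ((csSeg n m).image π)ᶜ := by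
    intro Z
    have : ∀ π : Equiv.Perm (Fin n), ((csSeg n m).image π)ᶜ = ((csSeg n m)ᶜ).image π := by
      intro π
      apply Finset.coe_injective
      simp [Set.image_compl_eq π.bijective]
    simp only [this]
    refine cs_perm_card (g Z) _ _ ?_
    rw [csSeg_card _ (by omega), Finset.card_compl, hcm, Fintype.card_fin]
  have hcard : ∀ π : Equiv.Perm (Fin n), ((csSeg n m).image π).card = m := by
    intro π
    rw [Finset.card_image_of_injective _ π.injective, hcm]
  -- pointwise facts
  have p1 : ∀ J : Finset (Fin n), J.card = m → g {2} Jᶜ = h {Sum.inr 0} + g {1} J := by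
    intro J hJ
    have := hdec J hJ
    simp only [g, Finset.image_singleton]
    rw [← this, Finset.union_comm]
  have p2 : ∀ J : Finset (Fin n), J.card = m → h {Sum.inr 0} + g ∅ J ≤ g {1, 2} Jᶜ := by
    intro J hJ
    have h1 := hssa {Sum.inr 0} (J.image Sum.inl) {Sum.inr 1} (by simp) (by simp) (by simp)
    have h2 := hdec J hJ
    have h3 := hc (Jᶜ.image Sum.inl ∪ {Sum.inr 2})
    have h4 := hc (({1, 2} : Finset (Fin 3)).image Sum.inr ∪ Jᶜ.image Sum.inl)
    have e3 : (Jᶜ.image Sum.inl ∪ {Sum.inr 2} : Finset (Fin n ⊕ Fin 3))ᶜ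
        = {Sum.inr 0} ∪ J.image Sum.inl ∪ {Sum.inr 1} := by
      ext x
      rcases x with x | x
      · simp
      · fin_cases x <;> simp
    have e4 : (({1, 2} : Finset (Fin 3)).image Sum.inr ∪ Jᶜ.image Sum.inl
        : Finset (Fin n ⊕ Fin 3))ᶜ = {Sum.inr 0} ∪ J.image Sum.inl := by
      ext x
      rcases x with x | x
      · simp
      · fin_cases x <;> simp
    rw [e3] at h3
    rw [e4] at h4
    simp only [g, Finset.image_empty, Finset.empty_union]
    rw [← h4]
    rw [Finset.union_comm (J.image Sum.inl) {Sum.inr 1}] at h1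
    linarith
  have p3 : ∀ Z (J : Finset (Fin n)), g Z J ≤ h (Z.image Sum.inr) + g ∅ J := by
    intro Z J
    have := hsub _ _ (hdisj Z J)
    simpa [g] using this
  have p4 : ∀ J : Finset (Fin n), g {1, 2} J ≤ g {1} J + h {Sum.inr 2} := by
    intro J
    have := hsub (({1} : Finset (Fin 3)).image Sum.inr ∪ J.image Sum.inl) {Sum.inr 2} (by simp)
    simp only [g]
    convert this using 2
    ext x; simp
  -- summed facts
  have s1 : u {2} (n - m) = N * h {Sum.inr 0} + u {1} m := by
    rw [hflip, ← hconst]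
    simp only [u]
    rw [← Finset.sum_add_distrib]
    exact Finset.sum_congr rfl fun π _ => p1 _ (hcard π)
  have s2 : N * h {Sum.inr 0} + u ∅ m ≤ u {1, 2} (n - m) := by
    rw [hflip, ← hconst]
    simp only [u]
    rw [← Finset.sum_add_distrib]
    exact Finset.sum_le_sum fun π _ => p2 _ (hcard π)
  have s3 : ∀ Z, u Z m - u Z 0 ≤ u ∅ m := by
    intro Z
    rw [hu0, ← hconst, sub_le_iff_le_add, add_comm]
    simp only [u]
    rw [← Finset.sum_add_distrib]
    exact Finset.sum_le_sum fun π _ => p3 _ _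
  have s4 : u {1, 2} m ≤ u {1} m + N * h {Sum.inr 2} := by
    rw [← hconst]
    simp only [u]
    rw [← Finset.sum_add_distrib]
    exact Finset.sum_le_sum fun π _ => p4 _
  have s5 : u {2} m ≤ u ∅ m + N * h {Sum.inr 2} := by
    have h1 := s3 {2}
    rw [hu0, Finset.image_singleton] at h1
    linarith
  have hpos : (0:ℝ) < (n : ℝ) - 2 * m := by
    have : ((2 * m : ℕ) : ℝ) < n := by exact_mod_cast hmn
    push_cast at this
    linarith
  have hm' : (0:ℝ) < m := by exact_mod_cast hm
  have t1 := (hconc {2}).trans (mul_le_mul_of_nonneg_left (s3 {2}) hpos.le)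
  have t2 := (hconc {1, 2}).trans (mul_le_mul_of_nonneg_left (s3 {1, 2}) hpos.le)
  have avg := cs_perm_avg (fun J => h (J.image Sum.inl)) (csSeg n m)
  rw [hcm] at avg
  have hum : u ∅ m = ∑ π : Equiv.Perm (Fin n), h (((csSeg n m).image π).image Sum.inl) := by
    simp [u, g]
  rw [← hum] at avg
  set T := ∑ J ∈ Finset.powersetCard m (Finset.univ : Finset (Fin n)), h (J.image Sum.inl) with hT
  have hch : (0:ℝ) < (n.choose m : ℝ) := by
    have := Nat.choose_pos (show m ≤ n by omega)
    exact_mod_cast this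
  have hTu : T / (n.choose m : ℝ) = u ∅ m / N := by
    rw [div_eq_div_iff hch.ne' hN.ne']
    linarith
  rw [hTu]
  have key : (m : ℝ) * (N * (h {Sum.inr 0} - h {Sum.inr 2})) ≤ ((n : ℝ) - 2 * m) * u ∅ m := by
    have a1 : u {2} (n - m) - u {2} m + (u {1, 2} (n - m) - u {1, 2} m)
        ≥ 2 * (N * (h {Sum.inr 0} - h {Sum.inr 2})) := by
      linarith
    have a2 := mul_le_mul_of_nonneg_left a1 hm'.le
    linarith
  have : ((n : ℝ) - 2 * m) * (1 / (m : ℝ) * (u ∅ m / N)) = (((n : ℝ) - 2 * m) * u ∅ m) / (m * N) := by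
    field_simp
  rw [this, le_div_iff₀ (by positivity)]
  linarith

end


end CatalyticSingleton


/-- catalytic quantum Singleton bound, case `2(d-1) < n`.
Systems: `A_f = Sum.inr 0`, `F = Sum.inr 1`, `B_in = Sum.inr 2`. -/
theorem catalytic_singleton_small_distance
    (n d q : ℕ) (hq : 2 ≤ q) (hd : 2 ≤ d) (hdn : 2 * (d - 1) < n)
    (dim : Fin n ⊕ Fin 3 → ℕ)
    (hdimX : ∀ i : Fin n, dim (Sum.inl i) = q)
    (ψ : Matrix ((i : Fin n ⊕ Fin 3) → Fin (dim i))
                ((i : Fin n ⊕ Fin 3) → Fin (dim i)) ℂ)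
    (hpsd : ψ.PosSemidef) (htr : ψ.trace = 1) (hpure : ψ.rank = 1)
    (hdec : ∀ I J : Finset (Fin n), Disjoint I J → I ∪ J = Finset.univ →
      I.card = n - d + 1 → J.card = d - 1 →
      mEnt ψ (I.image Sum.inl ∪ ({Sum.inr 2} : Finset (Fin n ⊕ Fin 3))) =
        mEnt ψ ({Sum.inr 0} : Finset (Fin n ⊕ Fin 3)) + mEnt ψ (({Sum.inr 1} : Finset (Fin n ⊕ Fin 3)) ∪ J.image Sum.inl)) :
    mEnt ψ ({Sum.inr 0} : Finset (Fin n ⊕ Fin 3)) - mEnt ψ ({Sum.inr 2} : Finset (Fin n ⊕ Fin 3))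
      ≤ ((n : ℝ) - 2 * d + 2) * ((1 / ((d : ℝ) - 1)) *
          ((∑ J ∈ Finset.powersetCard (d - 1) (Finset.univ : Finset (Fin n)),
            mEnt ψ (J.image Sum.inl)) / (n.choose (d - 1) : ℝ)))
    ∧ ((n : ℝ) - 2 * d + 2) * ((1 / ((d : ℝ) - 1)) *
          ((∑ J ∈ Finset.powersetCard (d - 1) (Finset.univ : Finset (Fin n)),
            mEnt ψ (J.image Sum.inl)) / (n.choose (d - 1) : ℝ)))
      ≤ ((n : ℝ) - 2 * d + 2) * Real.log q := by
  obtain ⟨m, rfl⟩ : ∃ m, d = m + 1 := ⟨d - 1, by omega⟩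
  simp only [Nat.add_sub_cancel] at *
  have hm : 1 ≤ m := by omega
  have hcoef : (n : ℝ) - 2 * ((m + 1 : ℕ) : ℝ) + 2 = (n : ℝ) - 2 * m := by push_cast; ring
  have hdm : ((m + 1 : ℕ) : ℝ) - 1 = m := by push_cast; ring
  rw [hcoef, hdm]
  have hpos : (0:ℝ) < (n : ℝ) - 2 * m := by
    have : ((2 * m : ℕ) : ℝ) < n := by exact_mod_cast hdn
    push_cast at this
    linarith
  have hm' : (0:ℝ) < m := by exact_mod_cast hm
  have hch : (0:ℝ) < (n.choose m : ℝ) := by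
    have := Nat.choose_pos (show m ≤ n by omega)
    exact_mod_cast this
  constructor
  · refine CatalyticSingleton.cs_combi m hm hdn (mEnt ψ)
      (CatalyticSingleton.cs_mEnt_empty ψ hpsd htr)
      (CatalyticSingleton.cs_mEnt_compl ψ hpsd htr hpure)
      (CatalyticSingleton.cs_ssa ψ hpsd htr) ?_
    intro J hJ
    refine hdec Jᶜ J disjoint_compl_left ?_ ?_ hJ
    · rw [Finset.union_comm, Finset.union_compl]
    · rw [Finset.card_compl, hJ, Fintype.card_fin]
      omega
  · refine mul_le_mul_of_nonneg_left ?_ hpos.le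
    have hJ : ∀ J ∈ Finset.powersetCard m (Finset.univ : Finset (Fin n)),
        mEnt ψ (J.image Sum.inl) ≤ m * Real.log q := by
      intro J hJ
      have h1 := CatalyticSingleton.cs_mEnt_le ψ hpsd htr (J.image Sum.inl)
      rw [Finset.sum_image (by simp)] at h1
      simp only [hdimX, Finset.sum_const, (Finset.mem_powersetCard.1 hJ).2, nsmul_eq_mul] at h1
      exact h1
    have h2 := Finset.sum_le_card_nsmul _ _ _ hJ
    rw [Finset.card_powersetCard, Finset.card_univ, Fintype.card_fin, nsmul_eq_mul] at h2
    rw [one_div, inv_mul_le_iff₀ hm', div_le_iff₀ hch]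
    linarith
end

section
/- Catalytic quantum Singleton bound, case 2(d−1) ≥ n. Let q ≥ 2, 2 ≤ d ≤ n, and 2(d−1) ≥ n. Let ψ be a pure quantum state on A_f ⊗ F ⊗ X_1 ⊗ … ⊗ X_n ⊗ B_in, where each X_i has dimension q and A_f, F, B_in are arbitrary finite-dimensional systems. Suppose that for every partition {1,…,n} = I ∪ J with |I| = n−d+1 and |J| = d−1, the equality S(X_I B_in)_ψ = S(A_f)_ψ + S(F X_J)_ψ holds. Then S(A_f)_ψ − S(B_in)_ψ ≤ 0, i.e., no net entanglement can be generated. -/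
open scoped BigOperators ComplexOrder

namespace CatSing
open Matrix Kronecker

lemma vnEntropy_eq_roots {m : Type*} [Fintype m] [DecidableEq m] {ρ : Matrix m m ℂ}
    (h : ρ.IsHermitian) :
    vnEntropy ρ = (ρ.charpoly.roots.map (fun z => Real.negMulLog z.re)).sum := by
  rw [h.roots_charpoly_eq_eigenvalues, vnEntropy, dif_pos h, Multiset.map_map,
    ← Finset.sum_neg_distrib]
  change _ = ∑ j, _
  refine Finset.sum_congr rfl fun j _ => ?_
  simp [Real.negMulLog]

lemma vnEntropy_submatrix {m k : Type*} [Fintype m] [DecidableEq m] [Fintype k] [DecidableEq k]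
    {ρ : Matrix m m ℂ} (h : ρ.IsHermitian) (e : k ≃ m) :
    vnEntropy (ρ.submatrix e e) = vnEntropy ρ := by
  rw [vnEntropy_eq_roots h, vnEntropy_eq_roots (h.submatrix e)]
  have := charpoly_reindex e.symm ρ
  rw [reindex_apply] at this
  simp only [Equiv.symm_symm] at this
  rw [this]

lemma vnEntropy_mul_comm {m k : Type*} [Fintype m] [DecidableEq m] [Fintype k] [DecidableEq k]
    (M : Matrix m k ℂ) (N : Matrix k m ℂ) (h : (M * N).IsHermitian) (h' : (N * M)ᵀ.IsHermitian) :
    vnEntropy (M * N) = vnEntropy (N * M)ᵀ := by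
  rw [vnEntropy_eq_roots h, vnEntropy_eq_roots h', charpoly_transpose]
  have := congrArg (fun p => (p.roots.map (fun z => Real.negMulLog z.re)).sum)
    (charpoly_mul_comm' M N)
  have n1 := (charpoly_monic (M * N)).ne_zero
  have n2 := (charpoly_monic (N * M)).ne_zero
  simpa [Polynomial.roots_mul, n1, n2, Multiset.map_nsmul, Multiset.sum_nsmul] using this

lemma vnEntropy_diag {m : Type*} [Fintype m] [DecidableEq m] (U : Matrix m m ℂ)
    (hU : Uᴴ * U = 1) (a : m → ℝ) :
    vnEntropy (U * diagonal (fun i => (a i : ℂ)) * Uᴴ) = -∑ i, a i * Real.log (a i) := by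
  have h : (U * diagonal (fun i => (a i : ℂ)) * Uᴴ).IsHermitian := by
    apply isHermitian_mul_mul_conjTranspose
    apply isHermitian_diagonal_of_self_adjoint
    ext i; simp
  rw [vnEntropy_eq_roots h, charpoly_mul_comm, ← mul_assoc, hU, one_mul, charpoly_diagonal,
    Polynomial.roots_prod _ _ (by simp [Finset.prod_ne_zero_iff, Polynomial.X_sub_C_ne_zero]),
    ← Finset.sum_neg_distrib]
  simp [Real.negMulLog]

lemma exists_diag {m : Type*} [Fintype m] [DecidableEq m] {ρ : Matrix m m ℂ}
    (h : ρ.PosSemidef) : ∃ (U : Matrix m m ℂ) (a : m → ℝ), Uᴴ * U = 1 ∧ U * Uᴴ = 1 ∧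
      ρ = U * diagonal (fun i => (a i : ℂ)) * Uᴴ ∧ (∀ i, 0 ≤ a i) ∧
      ((∑ i, a i : ℝ) : ℂ) = ρ.trace := by
  refine ⟨h.1.eigenvectorUnitary, h.1.eigenvalues, ?_, ?_, ?_, h.eigenvalues_nonneg, ?_⟩
  · exact (Unitary.coe_star_mul_self h.1.eigenvectorUnitary)
  · exact (Unitary.coe_mul_star_self h.1.eigenvectorUnitary)
  · exact h.1.spectral_theorem
  · rw [h.1.trace_eq_sum_eigenvalues]; simp

lemma kl_point {r s : ℝ} (hr : 0 ≤ r) (hs : 0 < s) :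
    0 ≤ r * Real.log r - r * Real.log s - r + s ∧
    (r * Real.log r - r * Real.log s - r + s = 0 → r = s) := by
  have e : r * Real.log r - r * Real.log s - r + s = s * InformationTheory.klFun (r / s) := by
    rw [InformationTheory.klFun_apply]
    rcases hr.eq_or_lt with h | h
    · simp [← h]
    · rw [Real.log_div h.ne' hs.ne']; field_simp; ring
  rw [e]
  refine ⟨mul_nonneg hs.le (InformationTheory.klFun_nonneg (by positivity)), fun h => ?_⟩
  rcases mul_eq_zero.1 h with h | h
  · exact absurd h hs.ne'
  · rw [InformationTheory.klFun_eq_zero_iff (by positivity)] at h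
    field_simp at h; exact h

lemma classical {κ α β : Type*} [Fintype κ] [Fintype α] [Fintype β]
    (r : κ → ℝ) (a : α → ℝ) (b : β → ℝ) (P : κ → α × β → ℝ)
    (hr : ∀ k, 0 ≤ r k) (hP : ∀ k x, 0 ≤ P k x)
    (row : ∀ k, ∑ x, P k x = 1) (col : ∀ x, ∑ k, P k x = 1)
    (ha : ∀ i, a i = ∑ j, ∑ k, r k * P k (i, j)) (hb : ∀ j, b j = ∑ i, ∑ k, r k * P k (i, j))
    (h1 : ∑ k, r k = 1) :
    (-∑ k, r k * Real.log (r k) ≤ -∑ i, a i * Real.log (a i) + -∑ j, b j * Real.log (b j)) ∧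
    (-∑ k, r k * Real.log (r k) = -∑ i, a i * Real.log (a i) + -∑ j, b j * Real.log (b j) →
      ∀ k x, P k x ≠ 0 → r k = a x.1 * b x.2) := by
  have t0 : ∀ k x, 0 ≤ r k * P k x := fun k x => mul_nonneg (hr k) (hP k x)
  have a0 : ∀ i, 0 ≤ a i := fun i => by
    rw [ha]; exact Finset.sum_nonneg fun _ _ => Finset.sum_nonneg fun _ _ => t0 _ _
  have b0 : ∀ i, 0 ≤ b i := fun i => by
    rw [hb]; exact Finset.sum_nonneg fun _ _ => Finset.sum_nonneg fun _ _ => t0 _ _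
  have az : ∀ i, a i = 0 → ∀ j k, r k * P k (i, j) = 0 := by
    intro i hi j k
    rw [ha, Finset.sum_eq_zero_iff_of_nonneg
      (fun _ _ => Finset.sum_nonneg fun _ _ => t0 _ _)] at hi
    have := hi j (Finset.mem_univ _)
    rw [Finset.sum_eq_zero_iff_of_nonneg (fun _ _ => t0 _ _)] at this
    exact this k (Finset.mem_univ _)
  have bz : ∀ j, b j = 0 → ∀ i k, r k * P k (i, j) = 0 := by
    intro j hi i k
    rw [hb, Finset.sum_eq_zero_iff_of_nonneg
      (fun _ _ => Finset.sum_nonneg fun _ _ => t0 _ _)] at hi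
    have := hi i (Finset.mem_univ _)
    rw [Finset.sum_eq_zero_iff_of_nonneg (fun _ _ => t0 _ _)] at this
    exact this k (Finset.mem_univ _)
  have sa : ∑ i, a i = 1 := by
    simp_rw [ha]
    rw [← Fintype.sum_prod_type' (f := fun i j => ∑ k, r k * P k (i, j)), Finset.sum_comm]
    simp_rw [← Finset.mul_sum]
    simp only [Prod.mk.eta, row, mul_one, h1]
  have sb : ∑ j, b j = 1 := by
    simp_rw [hb]
    rw [Finset.sum_comm, ← Fintype.sum_prod_type' (f := fun i j => ∑ k, r k * P k (i, j)),
      Finset.sum_comm]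
    simp_rw [← Finset.mul_sum]
    simp only [Prod.mk.eta, row, mul_one, h1]
  set g : κ → α × β → ℝ := fun k x => P k x * (r k * Real.log (r k) -
    r k * (Real.log (a x.1) + Real.log (b x.2)) - r k + a x.1 * b x.2) with hg
  have key : ∀ k x, 0 ≤ g k x ∧ (g k x = 0 → P k x ≠ 0 → r k = a x.1 * b x.2) := by
    intro k x
    by_cases hz : a x.1 = 0 ∨ b x.2 = 0
    · have h0 : r k * P k x = 0 := hz.elim (fun h => az _ h x.2 k) (fun h => bz _ h x.1 k)
      have hs : a x.1 * b x.2 = 0 := mul_eq_zero.2 hz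
      have : g k x = 0 := by
        simp only [hg, hs]
        linear_combination (Real.log (r k) - (Real.log (a x.1) + Real.log (b x.2)) - 1) * h0
      refine ⟨this.ge, fun _ h => ?_⟩
      rw [hs]; exact (mul_eq_zero.1 h0).resolve_right h
    · push Not at hz
      have pa := (a0 x.1).lt_of_ne' hz.1
      have pb := (b0 x.2).lt_of_ne' hz.2
      have := kl_point (hr k) (mul_pos pa pb)
      rw [Real.log_mul hz.1 hz.2] at this
      refine ⟨mul_nonneg (hP k x) this.1, fun h h' => this.2 ((mul_eq_zero.1 h).resolve_left h')⟩
  have tot : ∑ k, ∑ x, g k x = ∑ k, r k * Real.log (r k) - ∑ i, a i * Real.log (a i)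
      - ∑ j, b j * Real.log (b j) := by
    have e : ∀ k x, g k x = r k * Real.log (r k) * P k x - r k * P k x * Real.log (a x.1)
      - r k * P k x * Real.log (b x.2) - r k * P k x + P k x * (a x.1 * b x.2) := by
      intro k x; simp only [hg]; ring
    simp_rw [e, Finset.sum_add_distrib, Finset.sum_sub_distrib]
    have e1 : ∑ k, ∑ x, r k * Real.log (r k) * P k x = ∑ k, r k * Real.log (r k) := by
      simp_rw [← Finset.mul_sum, row, mul_one]
    have e2 : ∑ k, ∑ x, r k * P k x = 1 := by
      simp_rw [← Finset.mul_sum, row, mul_one, h1]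
    have e3 : ∑ k, ∑ x : α × β, P k x * (a x.1 * b x.2) = 1 := by
      rw [Finset.sum_comm]
      simp_rw [← Finset.sum_mul, col, one_mul]
      rw [Fintype.sum_prod_type]
      simp_rw [← Finset.mul_sum, sb, mul_one, sa]
    have e4 : ∑ k, ∑ x : α × β, r k * P k x * Real.log (a x.1) = ∑ i, a i * Real.log (a i) := by
      rw [Finset.sum_comm, Fintype.sum_prod_type]
      refine Finset.sum_congr rfl fun i _ => ?_
      simp_rw [← Finset.sum_mul]
      rw [← ha]
    have e5 : ∑ k, ∑ x : α × β, r k * P k x * Real.log (b x.2) = ∑ i, b i * Real.log (b i) := by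
      rw [Finset.sum_comm, Fintype.sum_prod_type_right]
      refine Finset.sum_congr rfl fun i _ => ?_
      simp_rw [← Finset.sum_mul]
      rw [← hb]
    rw [e1, e2, e3, e4, e5]; ring
  have nn : 0 ≤ ∑ k, ∑ x, g k x :=
    Finset.sum_nonneg fun _ _ => Finset.sum_nonneg fun _ _ => (key _ _).1
  refine ⟨by linarith, fun h k x hx => (key k x).2 ?_ hx⟩
  have z : ∑ k, ∑ x, g k x = 0 := by linarith
  rw [Finset.sum_eq_zero_iff_of_nonneg
      (fun _ _ => Finset.sum_nonneg fun _ _ => (key _ _).1)] at z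
  have := z k (Finset.mem_univ _)
  rw [Finset.sum_eq_zero_iff_of_nonneg (fun _ _ => (key _ _).1)] at this
  exact this x (Finset.mem_univ _)

lemma kron_unit {α β : Type*} [Fintype α] [DecidableEq α] [Fintype β] [DecidableEq β]
    {U : Matrix α α ℂ} {V : Matrix β β ℂ} (hU : Uᴴ * U = 1) (hV : Vᴴ * V = 1) :
    (U ⊗ₖ V)ᴴ * (U ⊗ₖ V) = 1 := by
  rw [conjTranspose_kronecker, ← mul_kronecker_mul, hU, hV, one_kronecker_one]

lemma diag_kron {α β : Type*} [Fintype α] [DecidableEq α] [Fintype β] [DecidableEq β]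
    (U : Matrix α α ℂ) (V : Matrix β β ℂ) (a : α → ℝ) (b : β → ℝ) :
    (U * diagonal (fun i => (a i : ℂ)) * Uᴴ) ⊗ₖ (V * diagonal (fun i => (b i : ℂ)) * Vᴴ) =
    (U ⊗ₖ V) * diagonal (fun x : α × β => ((a x.1 * b x.2 : ℝ) : ℂ)) * (U ⊗ₖ V)ᴴ := by
  rw [mul_kronecker_mul, mul_kronecker_mul, conjTranspose_kronecker, diagonal_kronecker_diagonal]
  simp

lemma vnEntropy_kron {α β : Type*} [Fintype α] [DecidableEq α] [Fintype β] [DecidableEq β]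
    {A : Matrix α α ℂ} {B : Matrix β β ℂ} (hA : A.PosSemidef) (hB : B.PosSemidef)
    (tA : A.trace = 1) (tB : B.trace = 1) :
    vnEntropy (A ⊗ₖ B) = vnEntropy A + vnEntropy B := by
  obtain ⟨U, a, hU, -, eA, a0, sa⟩ := exists_diag hA
  obtain ⟨V, b, hV, -, eB, b0, sb⟩ := exists_diag hB
  rw [tA] at sa; rw [tB] at sb
  norm_cast at sa sb
  rw [eA, eB, diag_kron, vnEntropy_diag _ (kron_unit hU hV), vnEntropy_diag _ hU,
    vnEntropy_diag _ hV, Fintype.sum_prod_type]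
  have : ∀ i j, a i * b j * Real.log (a i * b j) =
      (a i * Real.log (a i)) * b j + a i * (b j * Real.log (b j)) := by
    intro i j
    by_cases h : a i = 0
    · simp [h]
    by_cases h' : b j = 0
    · simp [h']
    rw [Real.log_mul h h']; ring
  simp_rw [this, Finset.sum_add_distrib, ← Finset.mul_sum, sb, ← Finset.sum_mul, sa]
  ring

/-- partial trace over the second factor -/
def trR {α β : Type*} [Fintype β] (ρ : Matrix (α × β) (α × β) ℂ) : Matrix α α ℂ :=
  fun i i' => ∑ j, ρ (i, j) (i', j)
/-- partial trace over the first factor -/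
def trL {α β : Type*} [Fintype α] (ρ : Matrix (α × β) (α × β) ℂ) : Matrix β β ℂ :=
  fun j j' => ∑ i, ρ (i, j) (i, j')

lemma trR_conj {α β : Type*} [Fintype α] [DecidableEq α] [Fintype β] [DecidableEq β]
    (ρ : Matrix (α × β) (α × β) ℂ) (U : Matrix α α ℂ) (V : Matrix β β ℂ) (hV : V * Vᴴ = 1) :
    trR ((U ⊗ₖ V)ᴴ * ρ * (U ⊗ₖ V)) = Uᴴ * trR ρ * U := by
  have hv : ∀ y y', ∑ j, V y j * star (V y' j) = if y = y' then 1 else 0 := by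
    intro y y'
    have := congrFun (congrFun hV y) y'
    simpa [Matrix.mul_apply, Matrix.one_apply] using this
  ext i i'
  simp only [trR, Matrix.mul_apply, conjTranspose_apply, kroneckerMap_apply,
    Fintype.sum_prod_type, Finset.sum_mul, Finset.mul_sum, star_mul']
  calc _ = ∑ x, ∑ y, ∑ x', ∑ y', (∑ j, V y j * star (V y' j)) * (star (U x' i) * ρ (x', y') (x, y) * U x i') := by
        simp only [Finset.sum_mul]
        rw [Finset.sum_comm]
        refine Finset.sum_congr rfl fun x _ => ?_
        rw [Finset.sum_comm]
        refine Finset.sum_congr rfl fun y _ => ?_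
        rw [Finset.sum_comm]
        refine Finset.sum_congr rfl fun x' _ => ?_
        rw [Finset.sum_comm]
        refine Finset.sum_congr rfl fun y' _ => ?_
        refine Finset.sum_congr rfl fun j _ => ?_
        ring
    _ = _ := by
        simp only [hv, ite_mul, one_mul, zero_mul, Finset.sum_ite_eq, Finset.mem_univ, if_true]
        refine Finset.sum_congr rfl fun x _ => ?_
        rw [Finset.sum_comm]

lemma trL_conj {α β : Type*} [Fintype α] [DecidableEq α] [Fintype β] [DecidableEq β]
    (ρ : Matrix (α × β) (α × β) ℂ) (U : Matrix α α ℂ) (V : Matrix β β ℂ) (hU : U * Uᴴ = 1) :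
    trL ((U ⊗ₖ V)ᴴ * ρ * (U ⊗ₖ V)) = Vᴴ * trL ρ * V := by
  have := trR_conj (ρ.submatrix Prod.swap Prod.swap) V U hU
  have e : trR (ρ.submatrix Prod.swap Prod.swap) = trL ρ := rfl
  rw [e] at this
  rw [← this]
  ext j j'
  simp only [trL, trR, Matrix.mul_apply, conjTranspose_apply, kroneckerMap_apply,
    Fintype.sum_prod_type, Finset.sum_mul, submatrix_apply, Prod.swap, star_mul']
  refine Finset.sum_congr rfl fun i _ => ?_
  rw [Finset.sum_comm]
  refine Finset.sum_congr rfl fun x _ => ?_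
  refine Finset.sum_congr rfl fun y _ => ?_
  rw [Finset.sum_comm]
  refine Finset.sum_congr rfl fun z _ => ?_
  refine Finset.sum_congr rfl fun t _ => ?_
  ring

lemma unit_row {m : Type*} [Fintype m] [DecidableEq m] {T : Matrix m m ℂ} (h : T * Tᴴ = 1)
    (k : m) : ∑ x, Complex.normSq (T k x) = 1 := by
  have := congrFun (congrFun h k) k
  simp only [Matrix.mul_apply, conjTranspose_apply, one_apply_eq] at this
  apply Complex.ofReal_injective
  rw [Complex.ofReal_sum, Complex.ofReal_one, ← this]
  refine Finset.sum_congr rfl fun i _ => ?_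
  rw [Complex.normSq_eq_conj_mul_self, mul_comm]; rfl

lemma unit_col {m : Type*} [Fintype m] [DecidableEq m] {T : Matrix m m ℂ} (h : Tᴴ * T = 1)
    (k : m) : ∑ x, Complex.normSq (T x k) = 1 := by
  have := congrFun (congrFun h k) k
  simp only [Matrix.mul_apply, conjTranspose_apply, one_apply_eq] at this
  apply Complex.ofReal_injective
  rw [Complex.ofReal_sum, Complex.ofReal_one, ← this]
  refine Finset.sum_congr rfl fun i _ => ?_
  rw [Complex.normSq_eq_conj_mul_self]; rfl

theorem klein {α β : Type*} [Fintype α] [DecidableEq α] [Fintype β] [DecidableEq β]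
    {ρ : Matrix (α × β) (α × β) ℂ} (h : ρ.PosSemidef) (ht : ρ.trace = 1)
    (hA : (trR ρ).PosSemidef) (hB : (trL ρ).PosSemidef) :
    vnEntropy ρ ≤ vnEntropy (trR ρ) + vnEntropy (trL ρ) ∧
    (vnEntropy ρ = vnEntropy (trR ρ) + vnEntropy (trL ρ) → ρ = trR ρ ⊗ₖ trL ρ) := by
  obtain ⟨W, r, hW, hW', eR, r0, sr⟩ := exists_diag h
  obtain ⟨U, a, hU, hU', eA, a0, -⟩ := exists_diag hA
  obtain ⟨V, b, hV, hV', eB, b0, -⟩ := exists_diag hB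
  rw [ht] at sr
  norm_cast at sr
  have hK := kron_unit hU hV
  have hK' : (U ⊗ₖ V) * (U ⊗ₖ V)ᴴ = 1 := mul_eq_one_comm.1 hK
  set K := U ⊗ₖ V with hKd
  set T := Wᴴ * K with hT
  have T1 : Tᴴ * T = 1 := by
    rw [hT, conjTranspose_mul, conjTranspose_conjTranspose, mul_assoc, ← mul_assoc W, hW', one_mul,
      hK]
  have T2 : T * Tᴴ = 1 := mul_eq_one_comm.1 T1
  have eσ : Kᴴ * ρ * K = Tᴴ * diagonal (fun k => (r k : ℂ)) * T := by
    rw [hT, conjTranspose_mul, conjTranspose_conjTranspose]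
    conv_lhs => rw [eR]
    simp only [mul_assoc]
  have dσ : ∀ x, (Kᴴ * ρ * K) x x = ((∑ k, r k * Complex.normSq (T k x) : ℝ) : ℂ) := by
    intro x
    rw [eσ, Matrix.mul_apply, Complex.ofReal_sum]
    refine Finset.sum_congr rfl fun k _ => ?_
    rw [mul_diagonal, conjTranspose_apply, Complex.ofReal_mul, Complex.normSq_eq_conj_mul_self]
    simp only [Complex.star_def]; ring
  have ea : Uᴴ * trR ρ * U = diagonal (fun i => (a i : ℂ)) := by
    rw [eA]
    rw [show Uᴴ * (U * diagonal (fun i => (a i : ℂ)) * Uᴴ) * U =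
      (Uᴴ * U) * diagonal (fun i => (a i : ℂ)) * (Uᴴ * U) by simp only [mul_assoc], hU, one_mul,
      mul_one]
  have eb : Vᴴ * trL ρ * V = diagonal (fun i => (b i : ℂ)) := by
    rw [eB]
    rw [show Vᴴ * (V * diagonal (fun i => (b i : ℂ)) * Vᴴ) * V =
      (Vᴴ * V) * diagonal (fun i => (b i : ℂ)) * (Vᴴ * V) by simp only [mul_assoc], hV, one_mul,
      mul_one]
  have ha : ∀ i, a i = ∑ j, ∑ k, r k * Complex.normSq (T k (i, j)) := by
    intro i
    have := congrFun (congrFun (trR_conj ρ U V hV') i) i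
    rw [ea, diagonal_apply_eq, ← hKd] at this
    simp only [trR, dσ] at this
    exact_mod_cast this.symm
  have hb : ∀ j, b j = ∑ i, ∑ k, r k * Complex.normSq (T k (i, j)) := by
    intro i
    have := congrFun (congrFun (trL_conj ρ U V hU') i) i
    rw [eb, diagonal_apply_eq, ← hKd] at this
    simp only [trL, dσ] at this
    exact_mod_cast this.symm
  have main := classical r a b (fun k x => Complex.normSq (T k x)) r0
    (fun _ _ => Complex.normSq_nonneg _) (unit_row T2) (unit_col T1) ha hb sr
  have sR : vnEntropy ρ = -∑ k, r k * Real.log (r k) := by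
    conv_lhs => rw [eR]
    exact vnEntropy_diag _ hW _
  have sA : vnEntropy (trR ρ) = -∑ k, a k * Real.log (a k) := by
    rw [eA]; exact vnEntropy_diag _ hU _
  have sB : vnEntropy (trL ρ) = -∑ k, b k * Real.log (b k) := by
    rw [eB]; exact vnEntropy_diag _ hV _
  rw [sR, sA, sB]
  refine ⟨main.1, fun heq => ?_⟩
  have hh := main.2 heq
  have comm : diagonal (fun k => (r k : ℂ)) * T =
      T * diagonal (fun x : α × β => ((a x.1 * b x.2 : ℝ) : ℂ)) := by
    ext k x
    rw [diagonal_mul, mul_diagonal]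
    by_cases hz : T k x = 0
    · simp [hz]
    · rw [hh k x (by simpa using hz), mul_comm]
  rw [eA, eB, diag_kron, ← hKd]
  have : Kᴴ * ρ * K = diagonal (fun x : α × β => ((a x.1 * b x.2 : ℝ) : ℂ)) := by
    rw [eσ, mul_assoc, comm, ← mul_assoc, T1, one_mul]
  rw [← this]
  calc ρ = (K * Kᴴ) * ρ * (K * Kᴴ) := by rw [hK', one_mul, mul_one]
    _ = _ := by simp only [mul_assoc]

section marg
variable {ι : Type*} [Fintype ι] [DecidableEq ι] {dim : ι → ℕ}

lemma memL {S R U : Finset ι} (hU : U = S ∪ R) {i : ι} (h : i ∈ S) : i ∈ U := by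
  rw [hU]; exact Finset.mem_union_left _ h

lemma memR {S R U : Finset ι} (hU : U = S ∪ R) {i : ι} (h : i ∈ R) : i ∈ U := by
  rw [hU]; exact Finset.mem_union_right _ h

lemma memO {S R U : Finset ι} (hU : U = S ∪ R) {i : ι} (h : i ∈ U) (h' : i ∉ S) : i ∈ R := by
  rw [hU] at h; exact (Finset.mem_union.1 h).resolve_left h'

/-- glue two configurations -/
def glue {S R U : Finset ι} (hU : U = S ∪ R)
    (x : (i : {j : ι // j ∈ S}) → Fin (dim i.1)) (w : (i : {j : ι // j ∈ R}) → Fin (dim i.1)) :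
    (i : {j : ι // j ∈ U}) → Fin (dim i.1) :=
  fun i => if h : i.1 ∈ S then x ⟨i.1, h⟩ else
    w ⟨i.1, memO hU i.2 h⟩

/-- configurations on a disjoint union are pairs of configurations -/
def glueEquiv {S R U : Finset ι} (hU : U = S ∪ R) (hd : Disjoint S R) :
    ((i : {j : ι // j ∈ S}) → Fin (dim i.1)) × ((i : {j : ι // j ∈ R}) → Fin (dim i.1)) ≃
    ((i : {j : ι // j ∈ U}) → Fin (dim i.1)) where
  toFun p := glue hU p.1 p.2
  invFun u := (fun i => u ⟨i.1, memL hU i.2⟩,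
    fun i => u ⟨i.1, memR hU i.2⟩)
  left_inv p := by
    refine Prod.ext ?_ ?_
    · funext i; simp [glue]
    · funext i
      have : i.1 ∉ S := fun h => Finset.disjoint_left.1 hd h i.2
      simp [glue, this]
  right_inv u := by
    funext i
    by_cases h : i.1 ∈ S <;> simp [glue, h]

/-- splitting of the complementary configurations -/
def outEquiv {S R U : Finset ι} (hU : U = S ∪ R) (hd : Disjoint S R) :
    ((i : {j : ι // j ∈ R}) → Fin (dim i.1)) × ((i : {j : ι // j ∉ U}) → Fin (dim i.1)) ≃
    ((i : {j : ι // j ∉ S}) → Fin (dim i.1)) where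
  toFun p i := if h : i.1 ∈ R then p.1 ⟨i.1, h⟩ else
    p.2 ⟨i.1, fun h' => by
      rw [hU, Finset.mem_union] at h'
      exact h'.elim i.2 h⟩
  invFun u := (fun i => u ⟨i.1, fun h => Finset.disjoint_left.1 hd h i.2⟩,
    fun i => u ⟨i.1, fun h => i.2 (memL hU h)⟩)
  left_inv p := by
    refine Prod.ext ?_ ?_
    · funext i; simp
    · funext i
      have : i.1 ∉ R := fun h => i.2 (memR hU h)
      simp [this]
  right_inv u := by
    funext i
    by_cases h : i.1 ∈ R <;> simp [h]

lemma marg_marg (ρ : Matrix ((i : ι) → Fin (dim i)) ((i : ι) → Fin (dim i)) ℂ)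
    {S R U : Finset ι} (hU : U = S ∪ R) (hd : Disjoint S R)
    (x y : (i : {j : ι // j ∈ S}) → Fin (dim i.1)) :
    marginal ρ S x y = ∑ w, marginal ρ U (glue hU x w) (glue hU y w) := by
  unfold marginal
  rw [← Fintype.sum_prod_type', ← (outEquiv hU hd).sum_comp]
  refine Finset.sum_congr rfl fun p _ => ?_
  have key : ∀ x : (i : {j : ι // j ∈ S}) → Fin (dim i.1),
      (fun i : ι => if h : i ∈ S then x ⟨i, h⟩ else (outEquiv hU hd p) ⟨i, h⟩ :
        (i : ι) → Fin (dim i)) = (fun i : ι => if h : i ∈ U then glue hU x p.1 ⟨i, h⟩ else p.2 ⟨i, h⟩) := by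
    intro x
    funext i
    by_cases h : i ∈ S
    · have : i ∈ U := memL hU h
      simp [h, this, glue]
    · by_cases h' : i ∈ R
      · have : i ∈ U := memR hU h'
        simp [h, h', this, glue, outEquiv]
      · have : i ∉ U := by rw [hU, Finset.mem_union]; tauto
        simp [h, h', this, outEquiv]
  rw [key x, key y]

lemma marg_psd {ρ : Matrix ((i : ι) → Fin (dim i)) ((i : ι) → Fin (dim i)) ℂ}
    (h : ρ.PosSemidef) (S : Finset ι) : (marginal ρ S).PosSemidef := by
  have : marginal ρ S = ∑ z : (i : {j : ι // j ∉ S}) → Fin (dim i.1),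
      ρ.submatrix (fun x i => if h : i ∈ S then x ⟨i, h⟩ else z ⟨i, h⟩)
        (fun x i => if h : i ∈ S then x ⟨i, h⟩ else z ⟨i, h⟩) := by
    ext x y
    simp [marginal, Matrix.sum_apply]
  rw [this]
  exact posSemidef_sum _ fun z _ => h.submatrix _

lemma marg_trace (ρ : Matrix ((i : ι) → Fin (dim i)) ((i : ι) → Fin (dim i)) ℂ)
    (S : Finset ι) : (marginal ρ S).trace = ρ.trace := by
  change ∑ x : ((i : {j : ι // j ∈ S}) → Fin (dim i.1)),
    ∑ z : ((i : {j : ι // j ∉ S}) → Fin (dim i.1)),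
      ρ (fun i => if h : i ∈ S then x ⟨i, h⟩ else z ⟨i, h⟩)
        (fun i => if h : i ∈ S then x ⟨i, h⟩ else z ⟨i, h⟩) = ∑ x, ρ x x
  rw [← Fintype.sum_prod_type',
    ← (Equiv.piEquivPiSubtypeProd (fun i => i ∈ S) (fun i => Fin (dim i))).symm.sum_comp]
  rfl

variable {ρ : Matrix ((i : ι) → Fin (dim i)) ((i : ι) → Fin (dim i)) ℂ}

lemma trR_marg {S R U : Finset ι} (hU : U = S ∪ R) (hd : Disjoint S R) :
    trR ((marginal ρ U).submatrix (glueEquiv hU hd) (glueEquiv hU hd)) = marginal ρ S := by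
  ext x y
  rw [marg_marg ρ hU hd]
  rfl

lemma trL_marg {S R U : Finset ι} (hU : U = S ∪ R) (hd : Disjoint S R) :
    trL ((marginal ρ U).submatrix (glueEquiv hU hd) (glueEquiv hU hd)) = marginal ρ R := by
  have hU' : U = R ∪ S := by rw [hU, Finset.union_comm]
  ext x y
  rw [marg_marg ρ hU' hd.symm]
  refine Finset.sum_congr rfl fun w _ => ?_
  have : ∀ x : (i : {j : ι // j ∈ R}) → Fin (dim i.1), glueEquiv hU hd (w, x) = glue hU' x w := by
    intro x
    funext i
    change glue hU w x i = _
    by_cases h : i.1 ∈ S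
    · have h' := Finset.disjoint_left.1 hd h
      simp [glue, h, h']
    · have h' := memO hU i.2 h
      simp [glue, h, h']
  rw [submatrix_apply, this, this]

lemma subadd (h : ρ.PosSemidef) (ht : ρ.trace = 1) {S R U : Finset ι} (hU : U = S ∪ R)
    (hd : Disjoint S R) :
    mEnt ρ U ≤ mEnt ρ S + mEnt ρ R ∧
    (mEnt ρ U = mEnt ρ S + mEnt ρ R →
      (marginal ρ U).submatrix (glueEquiv hU hd) (glueEquiv hU hd) =
        marginal ρ S ⊗ₖ marginal ρ R) := by
  have hp := marg_psd h U
  have t : ((marginal ρ U).submatrix (glueEquiv hU hd) (glueEquiv hU hd)).trace = 1 := by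
    rw [← ht, ← marg_trace ρ U]
    exact (glueEquiv hU hd).sum_comp (fun x => marginal ρ U x x)
  have := klein (hp.submatrix (glueEquiv hU hd)) t
    (by rw [trR_marg]; exact marg_psd h S) (by rw [trL_marg]; exact marg_psd h R)
  rw [trR_marg, trL_marg, vnEntropy_submatrix hp.1] at this
  exact this

lemma hered (h : ρ.PosSemidef) (ht : ρ.trace = 1) {S R R' : Finset ι} (hd : Disjoint S R)
    (hR : R' ⊆ R) (heq : mEnt ρ (S ∪ R) = mEnt ρ S + mEnt ρ R) :
    mEnt ρ (S ∪ R') = mEnt ρ S + mEnt ρ R' := by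
  have hprod := (subadd h ht rfl hd).2 heq
  have hd' : Disjoint S R' := hd.mono_right hR
  have hRR : R = R' ∪ (R \ R') := (Finset.union_sdiff_of_subset hR).symm
  have hdd : Disjoint R' (R \ R') := Finset.disjoint_sdiff
  have hU : S ∪ R = (S ∪ R') ∪ (R \ R') := by rw [Finset.union_assoc, ← hRR]
  have hUd : Disjoint (S ∪ R') (R \ R') :=
    Finset.disjoint_union_left.2 ⟨hd.mono_right Finset.sdiff_subset, hdd⟩
  have hprod' : (marginal ρ (S ∪ R')).submatrix (glueEquiv rfl hd') (glueEquiv rfl hd') =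
        marginal ρ S ⊗ₖ marginal ρ R' := by
    ext ⟨x, y⟩ ⟨x', y'⟩
    rw [submatrix_apply, marg_marg ρ hU hUd, kroneckerMap_apply, marg_marg ρ hRR hdd,
      Finset.mul_sum]
    refine Finset.sum_congr rfl fun w _ => ?_
    have key : ∀ (x : (i : {j : ι // j ∈ S}) → Fin (dim i.1))
        (y : (i : {j : ι // j ∈ R'}) → Fin (dim i.1)),
        glue hU (glueEquiv rfl hd' (x, y)) w = glueEquiv rfl hd (x, glue hRR y w) := by
      intro x y
      funext i
      change glue hU (glue rfl x y) w i = glue rfl x (glue hRR y w) i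
      by_cases h1 : i.1 ∈ S
      · simp [glue, h1]
      · by_cases h2 : i.1 ∈ R' <;> simp [glue, h1, h2]
    rw [key, key]
    exact congrFun (congrFun hprod (x, glue hRR y w)) (x', glue hRR y' w)
  have := vnEntropy_kron (marg_psd h S) (marg_psd h R') (by rw [marg_trace, ht])
    (by rw [marg_trace, ht])
  rw [← hprod', vnEntropy_submatrix (marg_psd h _).1] at this
  exact this

lemma rank_one {m : Type*} [Fintype m] [DecidableEq m] {ψ : Matrix m m ℂ} (h : ψ.IsHermitian)
    (hr : ψ.rank = 1) : ∃ a b : m → ℂ, ∀ x y, ψ x y = a x * b y := by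
  rw [h.rank_eq_card_non_zero_eigs, Fintype.card_eq_one_iff] at hr
  obtain ⟨⟨k, hk⟩, hu⟩ := hr
  have hz : ∀ j, j ≠ k → h.eigenvalues j = 0 := by
    intro j hj
    by_contra hc
    exact hj (congrArg Subtype.val (hu ⟨j, hc⟩))
  let W : Matrix m m ℂ := h.eigenvectorUnitary
  have e : ψ = W * diagonal (fun i => (h.eigenvalues i : ℂ)) * Wᴴ := h.spectral_theorem
  refine ⟨fun x => W x k * h.eigenvalues k, fun y => star (W y k), fun x y => ?_⟩
  conv_lhs => rw [e]
  rw [Matrix.mul_apply, Finset.sum_eq_single k]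
  · rw [mul_diagonal, conjTranspose_apply]
  · intro j _ hj
    rw [mul_diagonal, hz j hj]; simp
  · simp

lemma purity (h : ρ.PosSemidef) (hr : ρ.rank = 1) {S T : Finset ι} (hT : T = Sᶜ) :
    mEnt ρ S = mEnt ρ T := by
  obtain ⟨a, b, hab⟩ := rank_one h.1 hr
  subst hT
  let f : ((i : {j : ι // j ∈ S}) → Fin (dim i.1)) → ((i : {j : ι // j ∉ S}) → Fin (dim i.1)) →
    (i : ι) → Fin (dim i) := fun x z i => if h : i ∈ S then x ⟨i, h⟩ else z ⟨i, h⟩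
  let M : Matrix ((i : {j : ι // j ∈ S}) → Fin (dim i.1))
    ((i : {j : ι // j ∉ S}) → Fin (dim i.1)) ℂ := fun x z => a (f x z)
  let N : Matrix ((i : {j : ι // j ∉ S}) → Fin (dim i.1))
    ((i : {j : ι // j ∈ S}) → Fin (dim i.1)) ℂ := fun z y => b (f y z)
  let e : ((i : {j : ι // j ∉ S}) → Fin (dim i.1)) ≃ ((i : {j : ι // j ∈ Sᶜ}) → Fin (dim i.1)) :=
    { toFun := fun u i => u ⟨i.1, Finset.mem_compl.1 i.2⟩
      invFun := fun u i => u ⟨i.1, Finset.mem_compl.2 i.2⟩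
      left_inv := fun _ => rfl
      right_inv := fun _ => rfl }
  let e' : ((i : {j : ι // j ∈ S}) → Fin (dim i.1)) ≃ ((i : {j : ι // j ∉ Sᶜ}) → Fin (dim i.1)) :=
    { toFun := fun u i => u ⟨i.1, by simpa using i.2⟩
      invFun := fun u i => u ⟨i.1, by simpa using i.2⟩
      left_inv := fun _ => rfl
      right_inv := fun _ => rfl }
  have e1 : marginal ρ S = M * N := by
    ext x y
    rw [Matrix.mul_apply]
    exact Finset.sum_congr rfl fun z _ => hab _ _
  have e2 : (marginal ρ Sᶜ).submatrix e e = (N * M)ᵀ := by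
    ext z z'
    rw [transpose_apply, Matrix.mul_apply, submatrix_apply]
    unfold marginal
    rw [← e'.sum_comp]
    refine Finset.sum_congr rfl fun x _ => ?_
    have key : ∀ z : (i : {j : ι // j ∉ S}) → Fin (dim i.1),
        (fun i => if h : i ∈ Sᶜ then e z ⟨i, h⟩ else e' x ⟨i, h⟩) = f x z := by
      intro z
      funext i
      by_cases h : i ∈ S
      · have : i ∉ Sᶜ := by simpa using h
        simp [f, h, this, e']
      · have : i ∈ Sᶜ := by simpa using h
        simp [f, h, this, e]
    rw [key, key, hab, mul_comm]
  unfold mEnt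
  rw [← vnEntropy_submatrix (marg_psd h Sᶜ).1 e, e2, e1]
  apply vnEntropy_mul_comm
  · rw [← e1]; exact (marg_psd h _).1
  · rw [← e2]; exact (marg_psd h _).1.submatrix _

end marg
end CatSing

/-- catalytic quantum Singleton bound, case `2(d-1) ≥ n`:
no net entanglement can be generated.
Systems: `A_f = Sum.inr 0`, `F = Sum.inr 1`, `B_in = Sum.inr 2`. -/
theorem catalytic_singleton_large_distance
    (n d q : ℕ) (hq : 2 ≤ q) (hd : 2 ≤ d) (hdn : d ≤ n) (hdn2 : n ≤ 2 * (d - 1))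
    (dim : Fin n ⊕ Fin 3 → ℕ)
    (hdimX : ∀ i : Fin n, dim (Sum.inl i) = q)
    (ψ : Matrix ((i : Fin n ⊕ Fin 3) → Fin (dim i))
                ((i : Fin n ⊕ Fin 3) → Fin (dim i)) ℂ)
    (hpsd : ψ.PosSemidef) (htr : ψ.trace = 1) (hpure : ψ.rank = 1)
    (hdec : ∀ I J : Finset (Fin n), Disjoint I J → I ∪ J = Finset.univ →
      I.card = n - d + 1 → J.card = d - 1 →
      mEnt ψ (I.image Sum.inl ∪ ({Sum.inr 2} : Finset (Fin n ⊕ Fin 3))) =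
        mEnt ψ ({Sum.inr 0} : Finset (Fin n ⊕ Fin 3)) + mEnt ψ (({Sum.inr 1} : Finset (Fin n ⊕ Fin 3)) ∪ J.image Sum.inl)) :
    mEnt ψ ({Sum.inr 0} : Finset (Fin n ⊕ Fin 3)) - mEnt ψ ({Sum.inr 2} : Finset (Fin n ⊕ Fin 3)) ≤ 0 := by

  obtain ⟨I, hI⟩ : ∃ I : Finset (Fin n), I.card = n - d + 1 :=
    (Finset.exists_subset_card_eq (s := (Finset.univ : Finset (Fin n))) (n := n - d + 1)
      (by simp; omega)).imp fun _ h => h.2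
  obtain ⟨J', hIJ, hJ'⟩ : ∃ J' : Finset (Fin n), I ⊆ J' ∧ J'.card = d - 1 := by
    obtain ⟨t, h1, -, h2⟩ := Finset.exists_subsuperset_card_eq (Finset.subset_univ I)
      (n := d - 1) (by omega) (by simp; omega)
    exact ⟨t, h1, h2⟩
  have c1 := hdec I Iᶜ disjoint_compl_right (by simp) hI
    (by rw [Finset.card_compl, Fintype.card_fin]; omega)
  have c2 := hdec J'ᶜ J' disjoint_compl_left (by rw [Finset.union_comm]; simp)
    (by rw [Finset.card_compl, Fintype.card_fin]; omega) hJ'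
  have three : ∀ c : Fin 3, c = 0 ∨ c = 1 ∨ c = 2 := by decide
  have p2 : mEnt ψ (J'ᶜ.image Sum.inl ∪ ({Sum.inr 2} : Finset (Fin n ⊕ Fin 3))) =
      mEnt ψ (({Sum.inr 0} : Finset (Fin n ⊕ Fin 3)) ∪ (({Sum.inr 1} : Finset (Fin n ⊕ Fin 3)) ∪ J'.image Sum.inl)) := by
    apply CatSing.purity hpsd hpure
    ext x
    rcases x with i | c
    · simp
    · rcases three c with rfl | rfl | rfl <;> simp
  rw [p2] at c2
  have hh := CatSing.hered hpsd htr (R' := I.image Sum.inl) (by simp)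
    ((Finset.image_subset_image hIJ).trans Finset.subset_union_right) c2
  have p1 : mEnt ψ (({Sum.inr 0} : Finset (Fin n ⊕ Fin 3)) ∪ I.image Sum.inl) =
      mEnt ψ (({Sum.inr 2} : Finset (Fin n ⊕ Fin 3)) ∪ (({Sum.inr 1} : Finset (Fin n ⊕ Fin 3)) ∪ Iᶜ.image Sum.inl)) := by
    apply CatSing.purity hpsd hpure
    ext x
    rcases x with i | c
    · simp
    · rcases three c with rfl | rfl | rfl <;> simp
  have s1 := (CatSing.subadd hpsd htr (S := ({Sum.inr 2} : Finset (Fin n ⊕ Fin 3)))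
    (R := (({Sum.inr 1} : Finset (Fin n ⊕ Fin 3)) ∪ Iᶜ.image Sum.inl)) rfl (by simp)).1
  have s2 := (CatSing.subadd hpsd htr (S := I.image Sum.inl)
    (R := ({Sum.inr 2} : Finset (Fin n ⊕ Fin 3))) rfl (by simp)).1
  linarith
end

section
/- Coherent-information bound for entanglement-assisted codes. Let 2 ≤ d ≤ n, q ≥ 2, K ≥ 1, and let ψ be a pure quantum state on R ⊗ A_f ⊗ X_1 ⊗ … ⊗ X_n ⊗ B_in, where R has dimension K, each X_i has dimension q, A_f and B_in are arbitrary finite-dimensional systems, and the marginal of ψ on R is the maximally mixed state (1/K)·Id_K. Suppose that for every partition {1,…,n} = I ∪ J with |I| = n−d+1 and |J| = d−1, the equality S(X_I B_in)_ψ = S(R)_ψ + S(A_f)_ψ + S(X_J)_ψ holds. Then log K − ℓ ≤ E_{|I|=n−d+1} S(X_I)_ψ − E_{|J|=d−1} S(X_J)_ψ, where ℓ := S(B_in)_ψ − S(A_f)_ψ is the net entanglement consumption. -/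
open scoped BigOperators ComplexOrder

open Matrix in
theorem diag_bound {m m' : Type*} [Fintype m] [DecidableEq m] [Fintype m'] [DecidableEq m']
    (ρ : Matrix m m ℂ) (h : ρ.PosSemidef) (U : Matrix m m' ℂ) (h1 : U * Uᴴ = 1)
    (h2 : Uᴴ * U = 1) :
    vnEntropy ρ ≤ ∑ x, Real.negMulLog ((Uᴴ * ρ * U) x x).re := by
  have hH := h.1
  set V : Matrix m m ℂ := (hH.eigenvectorUnitary : Matrix m m ℂ) with hV
  have hVV : V * Vᴴ = 1 := by
    have := (Unitary.mem_iff.1 hH.eigenvectorUnitary.2).2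
    simpa [star_eq_conjTranspose] using this
  have hVV' : Vᴴ * V = 1 := by
    have := (Unitary.mem_iff.1 hH.eigenvectorUnitary.2).1
    simpa [star_eq_conjTranspose] using this
  have hsp : ρ = V * diagonal (fun k => (hH.eigenvalues k : ℂ)) * Vᴴ := by
    have := hH.spectral_theorem
    rw [Unitary.conjStarAlgAut_apply] at this
    simpa [star_eq_conjTranspose, Function.comp_def] using this
  set W : Matrix m' m ℂ := Uᴴ * V with hW
  have hW1 : W * Wᴴ = 1 := by
    rw [hW, conjTranspose_mul, conjTranspose_conjTranspose, Matrix.mul_assoc, ← Matrix.mul_assoc V,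
      hVV, Matrix.one_mul, h2]
  have hW2 : Wᴴ * W = 1 := by
    rw [hW, conjTranspose_mul, conjTranspose_conjTranspose, Matrix.mul_assoc, ← Matrix.mul_assoc U,
      h1, Matrix.one_mul, hVV']
  have hrow : ∀ x, ∑ k, Complex.normSq (W x k) = 1 := by
    intro x
    have := congrFun (congrFun hW1 x) x
    simp only [Matrix.mul_apply, conjTranspose_apply, one_apply_eq, RCLike.star_def,
      Complex.mul_conj] at this
    exact_mod_cast this
  have hcol : ∀ k, ∑ x, Complex.normSq (W x k) = 1 := by
    intro k
    have := congrFun (congrFun hW2 k) k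
    simp only [Matrix.mul_apply, conjTranspose_apply, one_apply_eq, RCLike.star_def,
      ← Complex.normSq_eq_conj_mul_self] at this
    exact_mod_cast this
  have hdiag : ∀ x, ((Uᴴ * ρ * U) x x).re = ∑ k, Complex.normSq (W x k) * hH.eigenvalues k := by
    intro x
    have e : Uᴴ * ρ * U = W * diagonal (fun k => (hH.eigenvalues k : ℂ)) * Wᴴ := by
      conv_lhs => rw [hsp]
      rw [hW, conjTranspose_mul, conjTranspose_conjTranspose]
      simp only [Matrix.mul_assoc]
    rw [e, Matrix.mul_apply]
    simp only [mul_diagonal, conjTranspose_apply, RCLike.star_def]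
    rw [Complex.re_sum]
    refine Finset.sum_congr rfl fun k _ => ?_
    rw [mul_right_comm, Complex.mul_conj, ← Complex.ofReal_mul, Complex.ofReal_re]
  have hJ : ∀ x, ∑ k, Complex.normSq (W x k) * Real.negMulLog (hH.eigenvalues k)
      ≤ Real.negMulLog ((Uᴴ * ρ * U) x x).re := by
    intro x
    rw [hdiag]
    have := Real.concaveOn_negMulLog.le_map_sum (t := Finset.univ)
      (w := fun k => Complex.normSq (W x k)) (p := fun k => hH.eigenvalues k)
      (fun k _ => Complex.normSq_nonneg _) (hrow x) (fun k _ => h.eigenvalues_nonneg k)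
    simpa using this
  refine le_trans (le_of_eq ?_) (Finset.sum_le_sum fun x _ => hJ x)
  rw [Finset.sum_comm]
  simp only [← Finset.sum_mul, hcol, one_mul]
  simp [vnEntropy, hH, Real.negMulLog]

theorem classical_subadd {A B : Type*} [Fintype A] [Fintype B] (r : A → B → ℝ)
    (h0 : ∀ i j, 0 ≤ r i j) (h1 : ∑ i, ∑ j, r i j = 1) :
    ∑ i, ∑ j, Real.negMulLog (r i j) ≤
      ∑ i, Real.negMulLog (∑ j, r i j) + ∑ j, Real.negMulLog (∑ i, r i j) := by
  set a := fun i => ∑ j, r i j with ha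
  set b := fun j => ∑ i, r i j with hb
  have key : ∀ i j, Real.negMulLog (r i j) ≤
      -(r i j * Real.log (a i)) - (r i j * Real.log (b j)) + (a i * b j - r i j) := by
    intro i j
    have hra : r i j ≤ a i := Finset.single_le_sum (f := fun j => r i j) (fun j _ => h0 i j) (Finset.mem_univ j)
    have hrb : r i j ≤ b j := Finset.single_le_sum (f := fun i => r i j) (fun i _ => h0 i j) (Finset.mem_univ i)
    rcases (h0 i j).eq_or_lt with h | h
    · rw [← h]; rw [← h] at hra hrb
      simp only [Real.negMulLog_zero]
      have := mul_nonneg hra hrb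
      linarith
    · have pa : 0 < a i := h.trans_le hra
      have pb : 0 < b j := h.trans_le hrb
      have := Real.log_le_sub_one_of_pos (x := a i * b j / r i j) (by positivity)
      rw [Real.log_div (by positivity) h.ne', Real.log_mul pa.ne' pb.ne'] at this
      have h3 := mul_le_mul_of_nonneg_left this h.le
      have h4 : r i j * (a i * b j / r i j - 1) = a i * b j - r i j := by field_simp
      rw [h4] at h3
      unfold Real.negMulLog
      linarith
  refine (Finset.sum_le_sum fun i _ => Finset.sum_le_sum fun j _ => key i j).trans (le_of_eq ?_)
  have hb1 : ∑ j, b j = 1 := by rw [hb, Finset.sum_comm, h1]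
  have ha1 : ∑ i, a i = 1 := h1
  simp only [Finset.sum_add_distrib, Finset.sum_sub_distrib, Finset.sum_neg_distrib, h1,
    ← Finset.mul_sum, hb1, mul_one, ha1, ← Finset.sum_mul]
  rw [Finset.sum_comm (f := fun i j => r i j * Real.log (b j))]
  simp only [← Finset.sum_mul, Real.negMulLog, neg_mul, Finset.sum_neg_distrib]
  change -∑ i, a i * Real.log (a i) - ∑ j, b j * Real.log (b j) + (_ - ∑ i, a i) =
    -∑ i, a i * Real.log (a i) + -∑ j, b j * Real.log (b j)
  rw [ha1]
  ring

open Matrix in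
theorem vn_eq {m : Type*} [Fintype m] [DecidableEq m] (ρ : Matrix m m ℂ) (hH : ρ.IsHermitian) :
    ∃ U : Matrix m m ℂ, U * Uᴴ = 1 ∧ Uᴴ * U = 1 ∧
      vnEntropy ρ = ∑ x, Real.negMulLog ((Uᴴ * ρ * U) x x).re := by
  set V : Matrix m m ℂ := (hH.eigenvectorUnitary : Matrix m m ℂ) with hV
  have hVV : V * Vᴴ = 1 := by
    have := (Unitary.mem_iff.1 hH.eigenvectorUnitary.2).2
    simpa [star_eq_conjTranspose] using this
  have hVV' : Vᴴ * V = 1 := by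
    have := (Unitary.mem_iff.1 hH.eigenvectorUnitary.2).1
    simpa [star_eq_conjTranspose] using this
  have hsp : ρ = V * diagonal (fun k => (hH.eigenvalues k : ℂ)) * Vᴴ := by
    have := hH.spectral_theorem
    rw [Unitary.conjStarAlgAut_apply] at this
    simpa [star_eq_conjTranspose, Function.comp_def] using this
  refine ⟨V, hVV, hVV', ?_⟩
  have e : Vᴴ * ρ * V = diagonal (fun k => (hH.eigenvalues k : ℂ)) := by
    conv_lhs => rw [hsp]
    calc _ = (Vᴴ * V) * diagonal (fun k => (hH.eigenvalues k : ℂ)) * (Vᴴ * V) := by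
          simp only [Matrix.mul_assoc]
      _ = _ := by rw [hVV', Matrix.one_mul, Matrix.mul_one]
  rw [e]
  simp [vnEntropy, hH, Real.negMulLog]

open Matrix in
theorem subadd {A B C : Type*} [Fintype A] [DecidableEq A] [Fintype B] [DecidableEq B]
    [Fintype C] [DecidableEq C] (e : A × B ≃ C) (ρ : Matrix C C ℂ) (h : ρ.PosSemidef)
    (htr : ρ.trace = 1) (ρA : Matrix A A ℂ) (ρB : Matrix B B ℂ)
    (hHA : ρA.IsHermitian) (hHB : ρB.IsHermitian)
    (hA : ∀ a a', ρA a a' = ∑ b, ρ (e (a, b)) (e (a', b)))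
    (hB : ∀ b b', ρB b b' = ∑ a, ρ (e (a, b)) (e (a, b'))) :
    vnEntropy ρ ≤ vnEntropy ρA + vnEntropy ρB := by
  obtain ⟨U, hU1, hU2, hUe⟩ := vn_eq ρA hHA
  obtain ⟨V, hV1, hV2, hVe⟩ := vn_eq ρB hHB
  set W : Matrix C (A × B) ℂ := (kroneckerMap (· * ·) U V).submatrix e.symm id with hW
  have hK1 : (kroneckerMap (· * ·) U V) * (kroneckerMap (· * ·) U V)ᴴ = 1 := by
    rw [conjTranspose_kronecker, ← mul_kronecker_mul, hU1, hV1, one_kronecker_one]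
  have hK2 : (kroneckerMap (· * ·) U V)ᴴ * (kroneckerMap (· * ·) U V) = 1 := by
    rw [conjTranspose_kronecker, ← mul_kronecker_mul, hU2, hV2, one_kronecker_one]
  have hW1 : W * Wᴴ = 1 := by
    rw [hW, conjTranspose_submatrix, ← submatrix_mul _ _ _ _ _ Function.bijective_id, hK1]
    simp
  have hW2 : Wᴴ * W = 1 := by
    rw [hW, conjTranspose_submatrix, ← submatrix_mul _ _ _ _ _ e.symm.bijective, hK2]
    simp
  have hb := diag_bound ρ h W hW1 hW2
  have hpsd : (Wᴴ * ρ * W).PosSemidef := h.conjTranspose_mul_mul_same W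
  have hent : ∀ i j, (Wᴴ * ρ * W) (i, j) (i, j) =
      ∑ a, ∑ b, ∑ a', ∑ b', star (U a i) * star (V b j) * ρ (e (a, b)) (e (a', b'))
        * (U a' i * V b' j) := by
    intro i j
    rw [Matrix.mul_assoc, Matrix.mul_apply, ← e.sum_comp, Fintype.sum_prod_type]
    refine Finset.sum_congr rfl fun a _ => Finset.sum_congr rfl fun b _ => ?_
    rw [Matrix.mul_apply, ← e.sum_comp, Fintype.sum_prod_type, Finset.mul_sum]
    refine Finset.sum_congr rfl fun a' _ => ?_
    rw [Finset.mul_sum]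
    refine Finset.sum_congr rfl fun b' _ => ?_
    simp [hW, conjTranspose_apply, kroneckerMap_apply]
    ring
  have hUU : ∀ a a', ∑ i, U a' i * star (U a i) = if a' = a then 1 else 0 := by
    intro a a'
    have := congrFun (congrFun hU1 a') a
    simpa [Matrix.mul_apply, Matrix.one_apply] using this
  have hVV : ∀ a a', ∑ i, V a' i * star (V a i) = if a' = a then 1 else 0 := by
    intro a a'
    have := congrFun (congrFun hV1 a') a
    simpa [Matrix.mul_apply, Matrix.one_apply] using this
  have hsA : ∀ i, ∑ j, (Wᴴ * ρ * W) (i, j) (i, j) = (Uᴴ * ρA * U) i i := by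
    intro i
    simp only [hent]
    rw [Finset.sum_comm, Matrix.mul_assoc, Matrix.mul_apply]
    refine Finset.sum_congr rfl fun a _ => ?_
    rw [Matrix.mul_apply, Finset.mul_sum]
    simp only [hA, Finset.sum_mul, Finset.mul_sum]
    rw [Finset.sum_comm]
    conv_rhs => rw [Finset.sum_comm]
    refine Finset.sum_congr rfl fun b _ => ?_
    rw [Finset.sum_comm]
    refine Finset.sum_congr rfl fun a' _ => ?_
    rw [Finset.sum_comm]
    have : ∀ b', ∑ j, star (U a i) * star (V b j) * ρ (e (a, b)) (e (a', b'))
        * (U a' i * V b' j) = star (U a i) * ρ (e (a, b)) (e (a', b')) * U a' i *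
          (if b' = b then 1 else 0) := by
      intro b'
      rw [← hVV, Finset.mul_sum]
      exact Finset.sum_congr rfl fun j _ => by ring
    simp only [this]
    simp [conjTranspose_apply, mul_assoc]
  have hsB : ∀ j, ∑ i, (Wᴴ * ρ * W) (i, j) (i, j) = (Vᴴ * ρB * V) j j := by
    intro j
    have : ∀ i, (Wᴴ * ρ * W) (i, j) (i, j) =
      ∑ b, ∑ b', ∑ a, ∑ a', star (U a i) * star (V b j) * ρ (e (a, b)) (e (a', b'))
        * (U a' i * V b' j) := by
      intro i
      rw [hent, Finset.sum_comm]
      refine Finset.sum_congr rfl fun b _ => ?_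
      rw [Finset.sum_comm (γ := B)]
      refine Finset.sum_congr rfl fun a _ => ?_
      rw [Finset.sum_comm]
    simp only [this]
    rw [Finset.sum_comm, Matrix.mul_assoc, Matrix.mul_apply]
    refine Finset.sum_congr rfl fun b _ => ?_
    rw [Matrix.mul_apply, Finset.mul_sum]
    simp only [hB, Finset.sum_mul, Finset.mul_sum]
    rw [Finset.sum_comm]
    refine Finset.sum_congr rfl fun b' _ => ?_
    rw [Finset.sum_comm]
    refine Finset.sum_congr rfl fun a _ => ?_
    rw [Finset.sum_comm]
    have : ∀ a', ∑ i, star (U a i) * star (V b j) * ρ (e (a, b)) (e (a', b'))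
        * (U a' i * V b' j) = star (V b j) * ρ (e (a, b)) (e (a', b')) * V b' j *
          (if a' = a then 1 else 0) := by
      intro a'
      rw [← hUU, Finset.mul_sum]
      exact Finset.sum_congr rfl fun j _ => by ring
    simp only [this]
    simp [conjTranspose_apply, mul_assoc]
  have htrW : (Wᴴ * ρ * W).trace = 1 := by
    rw [Matrix.trace_mul_comm, ← Matrix.mul_assoc, hW1, Matrix.one_mul, htr]
  have hcl := classical_subadd (fun i j => ((Wᴴ * ρ * W) (i, j) (i, j)).re)
    (fun i j => (Complex.le_def.1 (hpsd.diag_nonneg (i := (i, j)))).1)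
    (by
      have := congrArg Complex.re htrW
      simpa [Matrix.trace, Fintype.sum_prod_type] using this)
  simp only [← Complex.re_sum, hsA, hsB] at hcl
  rw [Fintype.sum_prod_type] at hb
  rw [hUe, hVe]
  exact hb.trans hcl

theorem marginal_psd {ι : Type*} [Fintype ι] [DecidableEq ι] {dim : ι → ℕ}
    (ρ : Matrix ((i : ι) → Fin (dim i)) ((i : ι) → Fin (dim i)) ℂ) (h : ρ.PosSemidef)
    (S : Finset ι) : (marginal ρ S).PosSemidef := by
  have : marginal ρ S = ∑ z : (i : {j : ι // j ∉ S}) → Fin (dim i.1),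
      ρ.submatrix (fun x i => if h : i ∈ S then x ⟨i, h⟩ else z ⟨i, h⟩)
        (fun x i => if h : i ∈ S then x ⟨i, h⟩ else z ⟨i, h⟩) := by
    ext x y
    simp [marginal, Matrix.sum_apply]
  rw [this]
  exact Matrix.posSemidef_sum _ fun z _ => h.submatrix _

theorem marginal_trace {ι : Type*} [Fintype ι] [DecidableEq ι] {dim : ι → ℕ}
    (ρ : Matrix ((i : ι) → Fin (dim i)) ((i : ι) → Fin (dim i)) ℂ)
    (S : Finset ι) : (marginal ρ S).trace = ρ.trace := by
  unfold Matrix.trace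
  rw [← (Equiv.piEquivPiSubtypeProd (fun i => i ∈ S) (fun i => Fin (dim i))).symm.sum_comp,
    Fintype.sum_prod_type]
  rfl

/-- Glue configurations. -/
def glue {ι : Type*} [DecidableEq ι] {dim : ι → ℕ} (S T : Finset ι)
    (a : (i : {j : ι // j ∈ S}) → Fin (dim i.1)) (b : (i : {j : ι // j ∈ T}) → Fin (dim i.1)) :
    (i : {j : ι // j ∈ S ∪ T}) → Fin (dim i.1) :=
  fun i => if h : i.1 ∈ S then a ⟨i.1, h⟩ else
    b ⟨i.1, (Finset.mem_union.1 i.2).resolve_left h⟩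

/-- Gluing is a bijection. -/
def glueEquiv {ι : Type*} [DecidableEq ι] {dim : ι → ℕ} (S T : Finset ι) (hd : Disjoint S T) :
    ((i : {j : ι // j ∈ S}) → Fin (dim i.1)) × ((i : {j : ι // j ∈ T}) → Fin (dim i.1)) ≃
    ((i : {j : ι // j ∈ S ∪ T}) → Fin (dim i.1)) where
  toFun p := glue S T p.1 p.2
  invFun c := (fun i => c ⟨i.1, Finset.mem_union_left _ i.2⟩,
    fun i => c ⟨i.1, Finset.mem_union_right _ i.2⟩)
  left_inv p := by
    refine Prod.ext (funext fun i => ?_) (funext fun i => ?_)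
    · simp [glue, i.2]
    · have : i.1 ∉ S := Finset.disjoint_right.1 hd i.2
      simp [glue, this]
  right_inv c := by
    funext i
    simp [glue]

/-- Complement of `S` splits. -/
def complEquiv {ι : Type*} [DecidableEq ι] {dim : ι → ℕ} (S T U : Finset ι) (hd : Disjoint S T)
    (hU : ∀ i, i ∈ U ↔ i ∈ S ∨ i ∈ T) :
    ((i : {j : ι // j ∈ T}) → Fin (dim i.1)) × ((i : {j : ι // j ∉ U}) → Fin (dim i.1)) ≃
    ((i : {j : ι // j ∉ S}) → Fin (dim i.1)) where
  toFun p := fun i => if h : i.1 ∈ T then p.1 ⟨i.1, h⟩ else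
    p.2 ⟨i.1, fun h' => ((hU _).1 h').elim i.2 h⟩
  invFun c := (fun i => c ⟨i.1, Finset.disjoint_right.1 hd i.2⟩,
    fun i => c ⟨i.1, fun h => i.2 ((hU _).2 (Or.inl h))⟩)
  left_inv p := by
    refine Prod.ext (funext fun i => ?_) (funext fun i => ?_)
    · simp
    · have : i.1 ∉ T := fun h => i.2 ((hU _).2 (Or.inr h))
      simp [this]
  right_inv c := by
    funext i
    by_cases h : i.1 ∈ T <;> simp [h]

theorem mEnt_subadd {ι : Type*} [Fintype ι] [DecidableEq ι] {dim : ι → ℕ}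
    (ρ : Matrix ((i : ι) → Fin (dim i)) ((i : ι) → Fin (dim i)) ℂ) (h : ρ.PosSemidef)
    (htr : ρ.trace = 1) (S T : Finset ι) (hd : Disjoint S T) :
    mEnt ρ (S ∪ T) ≤ mEnt ρ S + mEnt ρ T := by
  refine subadd (glueEquiv S T hd) _ (marginal_psd ρ h _) ((marginal_trace ρ _).trans htr) _ _
    (marginal_psd ρ h _).1 (marginal_psd ρ h _).1 ?_ ?_
  · intro a a'
    unfold marginal
    rw [← (complEquiv (dim := dim) S T (S ∪ T) hd (fun i => Finset.mem_union)).sum_comp,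
      Fintype.sum_prod_type]
    refine Finset.sum_congr rfl fun b _ => Finset.sum_congr rfl fun z _ => ?_
    congr 1 <;>
    · funext i
      by_cases h1 : i ∈ S <;> by_cases h2 : i ∈ T <;>
        simp [complEquiv, glueEquiv, glue, h1, h2]
  · intro b b'
    unfold marginal
    rw [← (complEquiv (dim := dim) T S (S ∪ T) hd.symm
      (fun i => Finset.mem_union.trans or_comm)).sum_comp, Fintype.sum_prod_type]
    refine Finset.sum_congr rfl fun b _ => Finset.sum_congr rfl fun z _ => ?_
    congr 1 <;>
    · funext i
      by_cases h1 : i ∈ S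
      · have h2 : i ∉ T := Finset.disjoint_left.1 hd h1
        simp [complEquiv, glueEquiv, glue, h1, h2]
      · by_cases h2 : i ∈ T <;> simp [complEquiv, glueEquiv, glue, h1, h2]

theorem vn_smul_one {m : Type*} [Fintype m] [DecidableEq m] (K : ℕ) (hK : 1 ≤ K)
    (hc : Fintype.card m = K) : vnEntropy ((K : ℂ)⁻¹ • (1 : Matrix m m ℂ)) = Real.log K := by
  have hH : ((K : ℂ)⁻¹ • (1 : Matrix m m ℂ)).IsHermitian := by
    simp [Matrix.IsHermitian, Matrix.conjTranspose_smul]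
  obtain ⟨U, h1, h2, h3⟩ := vn_eq _ hH
  have hK' : (K : ℝ) ≠ 0 := by positivity
  have hre : ((K : ℂ)⁻¹).re = (K : ℝ)⁻¹ := by
    rw [← Complex.ofReal_natCast, ← Complex.ofReal_inv, Complex.ofReal_re]
  rw [h3]
  simp only [Matrix.mul_smul, Matrix.smul_mul, Matrix.mul_one, h2, Matrix.smul_apply,
    Matrix.one_apply_eq, smul_eq_mul, mul_one, hre]
  simp [Real.negMulLog, hc, hK']

/-- coherent-information bound for entanglement-assisted codes:
`log K - ℓ ≤ E_I S(X_I) - E_J S(X_J)`, with `ℓ = S(B_in) - S(A_f)`.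
Systems: `R = Sum.inr 0`, `A_f = Sum.inr 1`, `B_in = Sum.inr 2`. -/
theorem ea_coherent_information_bound
    (n d q K : ℕ) (hd : 2 ≤ d) (hdn : d ≤ n) (hq : 2 ≤ q) (hK : 1 ≤ K)
    (dim : Fin n ⊕ Fin 3 → ℕ)
    (hdimX : ∀ i : Fin n, dim (Sum.inl i) = q)
    (hdimR : dim (Sum.inr 0) = K)
    (ψ : Matrix ((i : Fin n ⊕ Fin 3) → Fin (dim i))
                ((i : Fin n ⊕ Fin 3) → Fin (dim i)) ℂ)
    (hpsd : ψ.PosSemidef) (htr : ψ.trace = 1) (hpure : ψ.rank = 1)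
    (hmaxmix : marginal ψ ({Sum.inr 0} : Finset (Fin n ⊕ Fin 3)) = (K : ℂ)⁻¹ • 1)
    (hdec : ∀ I J : Finset (Fin n), Disjoint I J → I ∪ J = Finset.univ →
      I.card = n - d + 1 → J.card = d - 1 →
      mEnt ψ (I.image Sum.inl ∪ ({Sum.inr 2} : Finset (Fin n ⊕ Fin 3))) =
        mEnt ψ ({Sum.inr 0} : Finset (Fin n ⊕ Fin 3)) + mEnt ψ ({Sum.inr 1} : Finset (Fin n ⊕ Fin 3)) + mEnt ψ (J.image Sum.inl)) :
    Real.log K - (mEnt ψ ({Sum.inr 2} : Finset (Fin n ⊕ Fin 3)) - mEnt ψ ({Sum.inr 1} : Finset (Fin n ⊕ Fin 3)))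
      ≤ (∑ I ∈ Finset.powersetCard (n - d + 1) (Finset.univ : Finset (Fin n)),
            mEnt ψ (I.image Sum.inl)) / (n.choose (n - d + 1) : ℝ)
        - (∑ J ∈ Finset.powersetCard (d - 1) (Finset.univ : Finset (Fin n)),
            mEnt ψ (J.image Sum.inl)) / (n.choose (d - 1) : ℝ) := by
  have hR : mEnt ψ ({Sum.inr 0} : Finset (Fin n ⊕ Fin 3)) = Real.log K := by
    unfold mEnt
    rw [hmaxmix]
    refine vn_smul_one K hK ?_
    rw [Fintype.card_pi]
    simp only [Fintype.card_fin]
    refine (Finset.prod_coe_sort ({Sum.inr 0} : Finset (Fin n ⊕ Fin 3)) dim).trans ?_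
    simp [hdimR]
  set X : Finset (Fin n) → ℝ := fun I => mEnt ψ (I.image Sum.inl) with hX
  set c := Real.log K - (mEnt ψ ({Sum.inr 2} : Finset (Fin n ⊕ Fin 3)) -
    mEnt ψ ({Sum.inr 1} : Finset (Fin n ⊕ Fin 3))) with hc
  have key : ∀ I ∈ Finset.powersetCard (n - d + 1) (Finset.univ : Finset (Fin n)),
      c ≤ X I - X Iᶜ := by
    intro I hI
    have hIc := (Finset.mem_powersetCard.1 hI).2
    have h1 := hdec I Iᶜ disjoint_compl_right (by simp) hIc
      (by rw [Finset.card_compl, hIc, Fintype.card_fin]; omega)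
    have h2 := mEnt_subadd ψ hpsd htr (I.image Sum.inl) {Sum.inr 2} (by simp)
    simp only [hX, hc]
    linarith
  have hsum := Finset.sum_le_sum key
  have hcompl : ∑ I ∈ Finset.powersetCard (n - d + 1) (Finset.univ : Finset (Fin n)), X Iᶜ =
      ∑ J ∈ Finset.powersetCard (d - 1) (Finset.univ : Finset (Fin n)), X J := by
    refine Finset.sum_nbij' (fun I => Iᶜ) (fun J => Jᶜ) ?_ ?_ ?_ ?_ ?_
    · intro I hI
      simp only [Finset.mem_powersetCard, Finset.subset_univ, true_and] at hI ⊢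
      rw [Finset.card_compl, hI, Fintype.card_fin]; omega
    · intro I hI
      simp only [Finset.mem_powersetCard, Finset.subset_univ, true_and] at hI ⊢
      rw [Finset.card_compl, hI, Fintype.card_fin]; omega
    · simp
    · simp
    · simp
  have hch : n.choose (d - 1) = n.choose (n - d + 1) :=
    Nat.choose_symm_of_eq_add (by omega)
  have hpos : (0 : ℝ) < n.choose (n - d + 1) := by
    exact_mod_cast Nat.choose_pos (by omega)
  rw [Finset.sum_sub_distrib (f := X), hcompl, Finset.sum_const, Finset.card_powersetCard,
    Finset.card_univ, Fintype.card_fin, nsmul_eq_mul] at hsum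
  rw [hch, ← sub_div, le_div_iff₀ hpos, mul_comm]
  exact hsum
end
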